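/- arXiv:1710.09652 — 3 statements merged into one kernel-verified Lean document; each statement's English description precedes it below -/
import Mathlib

section
/- For every integer r ≥ 2, every 𝓕_{2r+1}-free coloured graph G on n vertices with δ(G) > ((6r−8)/(3r−1))·n is BK_{r+1}-free. -/
/-- A coloured graph structure on a weight function: symmetric, `{0,1,2}`-valued,
vanishing on the diagonal. -/
def IsColoured {V : Type*} (w : V → V → ℕ) : Prop :=
  (∀ x y, w x y = w y x) ∧ (∀ x y, w x y ≤ 2) ∧ (∀ x, w x x = 0)

/-- The coloured graph with weight function `f` on `Fin m` is a subgraph of `(V, w)`. -/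
def HasSub {V : Type*} (w : V → V → ℕ) {m : ℕ} (f : Fin m → Fin m → ℕ) : Prop :=
  ∃ φ : Fin m → V, Function.Injective φ ∧ ∀ x y, f x y ≤ w (φ x) (φ y)

/-- The red clique `RK_m`: every edge has weight `2`. -/
def RK (m : ℕ) : Fin m → Fin m → ℕ := fun x y => if x = y then 0 else 2

/-- The blue clique `BK_m`: every edge has weight `1`. -/
def BK (m : ℕ) : Fin m → Fin m → ℕ := fun x y => if x = y then 0 else 1

/-- The coloured graph `G_{t,i}` of order `t - i`: a red clique `RK_i` (the first `i`
vertices) and a blue clique `BK_{t-2i}`, joined by edges of weight `1`. -/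
def Gt (t i : ℕ) : Fin (t - i) → Fin (t - i) → ℕ :=
  fun x y => if x = y then 0 else if x.val < i ∧ y.val < i then 2 else 1

/-- `(V, w)` is `𝓕_t`-free, where `𝓕_t = {G_{t,i} : 1 ≤ i ≤ t/2}`. -/
def FamFree {V : Type*} (w : V → V → ℕ) (t : ℕ) : Prop :=
  ∀ i, 1 ≤ i → 2 * i ≤ t → ¬ HasSub w (Gt t i)

open Finset

/-- A red clique `I` inside a clique `K` with at least `m` vertices. -/
structure CliquePair {V : Type*} (w : V → V → ℕ) (m : ℕ) (K I : Finset V) : Prop where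
  sub : I ⊆ K
  blue : ∀ x ∈ K, ∀ y ∈ K, x ≠ y → 1 ≤ w x y
  red : ∀ x ∈ I, ∀ y ∈ I, x ≠ y → w x y = 2
  card : m ≤ #K

/-- A clique pair maximizing first `#K + #I` and then the total weight inside `K`. -/
structure OptimalPair {V : Type*} (w : V → V → ℕ) (m : ℕ) (K I : Finset V) : Prop
    extends CliquePair w m K I where
  max_card : ∀ K' I', CliquePair w m K' I' → #K' + #I' ≤ #K + #I
  max_weight : ∀ K' I', CliquePair w m K' I' → #K' + #I' = #K + #I →
    ∑ x ∈ K', ∑ y ∈ K', w x y ≤ ∑ x ∈ K, ∑ y ∈ K, w x y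

theorem CliquePair.exists_optimal {V : Type*} [Fintype V] {w : V → V → ℕ} {m : ℕ}
    {K₀ I₀ : Finset V} (h : CliquePair w m K₀ I₀) : ∃ K I, OptimalPair w m K I := by
  classical
  let A : Finset (Finset V × Finset V) := univ.filter fun p => CliquePair w m p.1 p.2
  obtain ⟨p, hpA, hp⟩ := A.exists_max_image (fun p => #p.1 + #p.2)
    ⟨(K₀, I₀), by simpa [A] using h⟩
  let A' := A.filter fun q => #q.1 + #q.2 = #p.1 + #p.2
  obtain ⟨q, hqA, hq⟩ := A'.exists_max_image (fun q => ∑ x ∈ q.1, ∑ y ∈ q.1, w x y)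
    ⟨p, by simp [A', hpA]⟩
  obtain ⟨hqA, hqp⟩ := mem_filter.1 hqA
  refine ⟨q.1, q.2, (mem_filter.1 hqA).2, fun K' I' h' => ?_, fun K' I' h' he => ?_⟩
  · rw [hqp]
    exact hp (K', I') (by simpa [A] using h')
  · exact hq (K', I') (mem_filter.2 ⟨by simpa [A] using h', by rw [← hqp]; exact he⟩)

theorem hasSub_Gt_of_subset {V : Type*} {w : V → V → ℕ} {t i : ℕ} {K I : Finset V}
    (hit : 2 * i ≤ t) (hIK : I ⊆ K)
    (blue : ∀ x ∈ K, ∀ y ∈ K, x ≠ y → 1 ≤ w x y)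
    (red : ∀ x ∈ I, ∀ y ∈ I, x ≠ y → w x y = 2)
    (hI : #I = i) (hK : #K = t - i) : HasSub w (Gt t i) := by
  classical
  let e₁ : Fin i ≃ I := (I.equivFinOfCardEq hI).symm
  have hD : #(K \ I) = t - i - i := by rw [card_sdiff_of_subset hIK, hI, hK]
  let e₂ : Fin (t - i - i) ≃ (K \ I : Finset V) := ((K \ I).equivFinOfCardEq hD).symm
  let φ : Fin (t - i) → V := fun x =>
    if h : x.val < i then (e₁ ⟨x, h⟩ : V) else (e₂ ⟨x.val - i, by omega⟩ : V)
  have hφI : ∀ x : Fin (t - i), x.val < i → φ x ∈ I := fun x h => by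
    simp only [φ, h, dite_true]; exact (e₁ _).2
  have hφD : ∀ x : Fin (t - i), ¬ x.val < i → φ x ∈ K \ I := fun x h => by
    simp only [φ, h, dite_false]; exact (e₂ _).2
  have hφK : ∀ x, φ x ∈ K := fun x => by
    by_cases h : x.val < i
    · exact hIK (hφI x h)
    · exact (mem_sdiff.1 (hφD x h)).1
  have hinj : Function.Injective φ := by
    intro x y hxy
    by_cases hx : x.val < i <;> by_cases hy : y.val < i
    · simp only [φ, hx, hy, dite_true] at hxy
      have := congrArg Fin.val (e₁.injective (Subtype.ext hxy))
      exact Fin.ext this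
    · exact absurd (hxy ▸ hφI x hx) (mem_sdiff.1 (hφD y hy)).2
    · exact absurd (hxy ▸ hφI y hy) (mem_sdiff.1 (hφD x hx)).2
    · simp only [φ, hx, hy, dite_false] at hxy
      have := congrArg Fin.val (e₂.injective (Subtype.ext hxy))
      simp only at this
      exact Fin.ext (by omega)
  refine ⟨φ, hinj, fun x y => ?_⟩
  unfold Gt
  split_ifs with hxy hlt
  · exact Nat.zero_le _
  · exact (red _ (hφI x hlt.1) _ (hφI y hlt.2) (hinj.ne hxy)).ge
  · exact blue _ (hφK x) _ (hφK y) (hinj.ne hxy)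

theorem CliquePair.card_add_card_le {V : Type*} {w : V → V → ℕ} {r : ℕ} {K I : Finset V}
    (h : CliquePair w (r + 1) K I) (hr : 1 ≤ r) (hfree : FamFree w (2 * r + 1))
    (hI : I.Nonempty) : #K + #I ≤ 2 * r := by
  by_contra! hlt
  have hcard := h.card
  have hIpos := hI.card_pos
  obtain ⟨i, hi1, hir, hiI, hiK⟩ : ∃ i, 1 ≤ i ∧ i ≤ r ∧ i ≤ #I ∧ 2 * r + 1 - i ≤ #K :=
    ⟨max 1 (2 * r + 1 - #K), by omega, by omega, by omega, by omega⟩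
  obtain ⟨J, hJI, hJ⟩ := exists_subset_card_eq hiI
  obtain ⟨Q, hJQ, hQK, hQ⟩ := exists_subsuperset_card_eq (n := 2 * r + 1 - i)
    (hJI.trans h.sub) (by omega) hiK
  exact hfree i hi1 (by omega) (hasSub_Gt_of_subset (by omega) hJQ
    (fun x hx y hy => h.blue x (hQK hx) y (hQK hy))
    (fun x hx y hy => h.red x (hJI hx) y (hJI hy)) hJ hQ)

theorem IsColoured.forall_insert {V : Type*} [DecidableEq V] {w : V → V → ℕ} (hw : IsColoured w)
    (p : ℕ → Prop) {v : V} {A : Finset V} (hv : ∀ y ∈ A, y ≠ v → p (w v y))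
    (hA : ∀ x ∈ A, ∀ y ∈ A, x ≠ y → p (w x y)) :
    ∀ x ∈ insert v A, ∀ y ∈ insert v A, x ≠ y → p (w x y) := by
  intro x hx y hy hxy
  rcases mem_insert.1 hx with hxv | hxA
  · subst hxv
    exact hv y ((mem_insert.1 hy).resolve_left hxy.symm) hxy.symm
  · rcases mem_insert.1 hy with hyv | hyA
    · subst hyv
      rw [hw.1]
      exact hv x hxA hxy
    · exact hA x hxA y hyA hxy

namespace OptimalPair

variable {V : Type*} {w : V → V → ℕ} {m : ℕ} {K I : Finset V}

theorem card_red_le (h : OptimalPair w m K I) {J : Finset V} (hJ : J ⊆ K)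
    (red : ∀ x ∈ J, ∀ y ∈ J, x ≠ y → w x y = 2) : #J ≤ #I := by
  have := h.max_card K J ⟨hJ, h.blue, red, h.card⟩
  omega

theorem eq_two_of_ne_one (h : OptimalPair w m K I) (hw : IsColoured w) {x y : V} (hx : x ∈ K)
    (hy : y ∈ K) (hxy : x ≠ y) (hne : w x y ≠ 1) : w x y = 2 := by
  have := h.blue x hx y hy hxy
  have := hw.2.1 x y
  omega

theorem sum_add_card_one (hw : IsColoured w) {v : V} {A : Finset V}
    (hv : ∀ y ∈ A, w v y ≠ 0) : ∑ y ∈ A, w v y + #{y ∈ A | w v y = 1} = 2 * #A := by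
  rw [card_filter, ← sum_add_distrib, mul_comm, ← smul_eq_mul, ← sum_const]
  refine sum_congr rfl fun y hy => ?_
  have := hv y hy
  have := hw.2.1 v y
  split_ifs <;> omega

variable [DecidableEq V]

theorem exists_one_of_notMem (h : OptimalPair w m K I) (hw : IsColoured w) {y : V}
    (hy : y ∈ K) (hyI : y ∉ I) : ∃ x ∈ I, w y x = 1 := by
  by_contra! hne
  have h2 : ∀ x ∈ I, w y x = 2 := fun x hx => by
    have h1 := h.blue y hy x (h.sub hx) (fun e => hyI (e ▸ hx))
    have := hne x hx
    have := hw.2.1 y x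
    omega
  have := h.card_red_le (J := insert y I) (insert_subset hy h.sub)
    (hw.forall_insert (· = 2) (fun x hx _ => h2 x hx) h.red)
  rw [card_insert_of_notMem hyI] at this
  omega

theorem exists_zero (h : OptimalPair w m K I) (hw : IsColoured w) (v : V) :
    ∃ u ∈ K, w v u = 0 := by
  by_contra! hne
  have hv : v ∉ K := fun hv => hne v hv (hw.2.2 v)
  have := h.max_card (insert v K) I ⟨h.sub.trans (subset_insert _ _),
    hw.forall_insert (1 ≤ ·) (fun x hx _ => Nat.one_le_iff_ne_zero.2 (hne x hx)) h.blue, h.red, by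
      rw [card_insert_of_notMem hv]; have := h.card; omega⟩
  rw [card_insert_of_notMem hv] at this
  omega

/-- Exchanging `u` for `v` yields a clique pair again. -/
theorem exchange (h : OptimalPair w m K I) (hw : IsColoured w) {u v : V} (hu : u ∈ K)
    (hv : ∀ y ∈ K, y ≠ u → w v y ≠ 0) {J : Finset V} (hJ : J ⊆ insert v (K.erase u))
    (red : ∀ x ∈ J, ∀ y ∈ J, x ≠ y → w x y = 2) :
    CliquePair w m (insert v (K.erase u)) J ∧ #(insert v (K.erase u)) = #K := by
  have hvK : v ∉ K.erase u := fun hm =>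
    hv v (mem_of_mem_erase hm) (ne_of_mem_erase hm) (hw.2.2 v)
  have hc : #(insert v (K.erase u)) = #K := by
    rw [card_insert_of_notMem hvK, card_erase_add_one hu]
  refine ⟨⟨hJ, ?_, red, hc ▸ h.card⟩, hc⟩
  exact hw.forall_insert (1 ≤ ·)
    (fun y hy _ => Nat.one_le_iff_ne_zero.2 (hv y (mem_of_mem_erase hy) (ne_of_mem_erase hy)))
    fun a ha b hb => h.blue a (mem_of_mem_erase ha) b (mem_of_mem_erase hb)

theorem exists_one_mem_red (h : OptimalPair w m K I) (hw : IsColoured w) {u v : V} (hu : u ∈ K)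
    (hv : ∀ y ∈ K, y ≠ u → w v y ≠ 0) {J : Finset V} (hJ : J ⊆ K.erase u)
    (red : ∀ x ∈ J, ∀ y ∈ J, x ≠ y → w x y = 2) (hcard : #J = #I) :
    ∃ y ∈ J, w v y = 1 := by
  by_contra! hne
  have h2 : ∀ y ∈ J, w v y = 2 := fun y hy => by
    have h0 := hv y (mem_of_mem_erase (hJ hy)) (ne_of_mem_erase (hJ hy))
    have := hne y hy
    have := hw.2.1 v y
    omega
  have hvJ : v ∉ J := fun hm => by
    have := h2 v hm
    rw [hw.2.2] at this
    omega
  obtain ⟨hp, hc⟩ := h.exchange hw hu hv (J := insert v J) (insert_subset_insert _ hJ)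
    (hw.forall_insert (· = 2) (fun y hy _ => h2 y hy) red)
  have := h.max_card _ _ hp
  rw [hc, card_insert_of_notMem hvJ] at this
  omega

theorem sum_insert_insert (hw : IsColoured w) {v : V} {A : Finset V} (hv : v ∉ A) :
    ∑ x ∈ insert v A, ∑ y ∈ insert v A, w x y =
      ∑ x ∈ A, ∑ y ∈ A, w x y + 2 * ∑ y ∈ A, w v y := by
  simp only [sum_insert hv, hw.2.2, sum_add_distrib, hw.1 _ v]
  ring

theorem card_one_le (h : OptimalPair w m K I) (hw : IsColoured w) {u v : V} (hu : u ∈ K)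
    (hv : ∀ y ∈ K, y ≠ u → w v y ≠ 0) {J : Finset V} (hJ : J ⊆ insert v (K.erase u))
    (red : ∀ x ∈ J, ∀ y ∈ J, x ≠ y → w x y = 2) (hcard : #J = #I) :
    #{y ∈ K | w u y = 1} ≤ #{y ∈ K.erase u | w v y = 1} := by
  have hvK : v ∉ K.erase u := fun hm =>
    hv v (mem_of_mem_erase hm) (ne_of_mem_erase hm) (hw.2.2 v)
  obtain ⟨hp, hc⟩ := h.exchange hw hu hv hJ red
  have hle := h.max_weight _ _ hp (by rw [hc, hcard])
  rw [sum_insert_insert hw hvK] at hle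
  have he : ∑ x ∈ K, ∑ y ∈ K, w x y =
      ∑ x ∈ K.erase u, ∑ y ∈ K.erase u, w x y + 2 * ∑ y ∈ K.erase u, w u y := by
    rw [← sum_insert_insert hw (notMem_erase u K), insert_erase hu]
  have h1 := sum_add_card_one hw (v := v) (A := K.erase u)
    fun y hy => hv y (mem_of_mem_erase hy) (ne_of_mem_erase hy)
  have h2 := sum_add_card_one hw (v := u) (A := K.erase u)
    fun y hy => Nat.one_le_iff_ne_zero.1
      (h.blue u hu y (mem_of_mem_erase hy) (ne_of_mem_erase hy).symm)
  have h3 : {y ∈ K | w u y = 1} = {y ∈ K.erase u | w u y = 1} := by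
    ext y
    simp only [mem_filter, mem_erase]
    refine ⟨fun ⟨a, b⟩ => ⟨⟨?_, a⟩, b⟩, fun ⟨a, b⟩ => ⟨a.2, b⟩⟩
    rintro rfl
    rw [hw.2.2] at b
    omega
  rw [h3]
  omega

theorem add_le_sum_of_ne {f : V → ℕ} {x y : V} (hx : x ∈ K) (hy : y ∈ K) (hxy : x ≠ y) :
    f x + f y ≤ ∑ z ∈ K, f z := by
  rw [← sum_pair hxy]
  exact sum_le_sum_of_subset (by simp [insert_subset_iff, hx, hy])

/-- A weighting `c` of `K` has deficiency at least `24` at every vertex as soon as this holds for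
the vertices missing a single `u ∈ K` and having at most one neighbour of weight `1` in `K`. -/
theorem deficiency_ge (h : OptimalPair w m K I) (hw : IsColoured w) (c : V → ℕ)
    (hc : ∀ x ∈ K, 6 ≤ c x) (hL : ∀ x ∈ K, (∀ y ∈ K, w x y ≠ 1) → 12 ≤ c x)
    (h0 : ∀ u ∈ K, ∀ v, (∀ y ∈ K, y ≠ u → w v y = 2) → 12 ≤ c u)
    (h1 : ∀ u ∈ K, ∀ v, ∀ u' ∈ K, u' ≠ u → w v u' = 1 → (∀ y ∈ K, y ≠ u → y ≠ u' → w v y = 2) →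
      (∃ y ∈ K, w u y = 1) → (∃ y ∈ K, w u' y = 1) → 24 ≤ 2 * c u + c u') (v : V) :
    24 ≤ ∑ y ∈ K, c y * (2 - w v y) := by
  obtain ⟨u, hu, huv⟩ := h.exists_zero hw v
  have hcu := hc u hu
  by_cases hM : ∃ z ∈ K, z ≠ u ∧ w v z = 0
  · obtain ⟨z, hz, hzu, hzv⟩ := hM
    have := add_le_sum_of_ne (f := fun y => c y * (2 - w v y)) hu hz hzu.symm
    simp only [huv, hzv] at this
    have := hc z hz
    omega
  push Not at hM
  by_cases hcu12 : 12 ≤ c u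
  · have := single_le_sum (f := fun y => c y * (2 - w v y)) (fun _ _ => Nat.zero_le _) hu
    simp only [huv] at this
    omega
  have huL : ∃ y ∈ K, w u y = 1 := by
    by_contra! hne
    exact hcu12 (hL u hu hne)
  by_cases hB : ∃ u' ∈ K, u' ≠ u ∧ w v u' = 1
  swap
  · push Not at hB
    refine absurd (h0 u hu v fun y hy hyu => ?_) hcu12
    have := hM y hy hyu
    have := hB y hy hyu
    have := hw.2.1 v y
    omega
  obtain ⟨u', hu', huu', hvu'⟩ := hB
  by_cases hB2 : ∃ z ∈ K, z ≠ u ∧ z ≠ u' ∧ w v z = 1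
  · obtain ⟨z, hz, hzu, hzu', hvz⟩ := hB2
    have h3 : ∑ y ∈ {u, u', z}, c y * (2 - w v y) ≤ ∑ y ∈ K, c y * (2 - w v y) :=
      sum_le_sum_of_subset (by simp [insert_subset_iff, hu, hu', hz])
    rw [sum_insert (by simp [huu'.symm, hzu.symm]), sum_pair hzu'.symm, huv, hvu', hvz] at h3
    have := hc z hz
    have := hc u' hu'
    omega
  push Not at hB2
  have h2 := add_le_sum_of_ne (f := fun y => c y * (2 - w v y)) hu hu' huu'.symm
  simp only [huv, hvu'] at h2
  by_cases hu'L : ∃ y ∈ K, w u' y = 1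
  · have := h1 u hu v u' hu' huu' hvu' (fun y hy hyu hyu' => by
      have := hM y hy hyu
      have := hB2 y hy hyu hyu'
      have := hw.2.1 v y
      omega) huL hu'L
    omega
  · push Not at hu'L
    have := hL u' hu' hu'L
    omega

theorem sum_ite_add_card_le {L S T : Finset V} (hIK : I ⊆ K) (hLI : L ⊆ I) (hSI : S ⊆ I)
    (hTK : T ⊆ K) (hTI : Disjoint T I) (hSL : Disjoint S L) :
    ∑ x ∈ K, (if x ∈ L then 12 else if x ∈ T ∨ x ∈ S then 8 else if x ∈ I then 9 else 6) + #S ≤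
      6 * #K + 3 * #L + 3 * #I + 2 * #T := by
  have hcount : ∀ (A : Finset V) (k : ℕ), A ⊆ K → k * #A = ∑ x ∈ K, if x ∈ A then k else 0 :=
    fun A k hA => by rw [sum_ite_mem, inter_eq_right.2 hA, sum_const, smul_eq_mul, mul_comm]
  have hK : 6 * #K = ∑ _x ∈ K, 6 := by rw [sum_const, smul_eq_mul, mul_comm]
  rw [hcount L 3 (hLI.trans hIK), hcount I 3 hIK, hcount T 2 hTK, hK, ← one_mul #S,
    hcount S 1 (hSI.trans hIK), ← sum_add_distrib, ← sum_add_distrib, ← sum_add_distrib,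
    ← sum_add_distrib]
  refine sum_le_sum fun x _ => ?_
  have e1 : x ∈ L → x ∈ I := fun hx => hLI hx
  have e2 : x ∈ S → x ∈ I := fun hx => hSI hx
  have e3 : x ∈ T → x ∉ I := fun hx => disjoint_left.1 hTI hx
  have e4 : x ∈ S → x ∉ L := fun hx => disjoint_left.1 hSL hx
  clear hcount hK hIK hLI hSI hTK hTI hSL
  grind

/-- `L` consists of the vertices of `K` joined to the rest of `K` by edges of weight `2` only. -/
theorem exists_weighting_of_two_le (h : OptimalPair w m K I) (hw : IsColoured w)
    {L : Finset V} (hLdef : ∀ x, x ∈ L ↔ x ∈ K ∧ ∀ y ∈ K, w x y ≠ 1) (hLI : L ⊆ I)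
    (hb : #L + 2 ≤ #I) :
    ∃ c : V → ℕ, (∀ x ∈ K, 6 ≤ c x) ∧ ∑ x ∈ K, c x + 4 ≤ 6 * (#K + #I) ∧
      ∀ v, 24 ≤ ∑ y ∈ K, c y * (2 - w v y) := by
  have hself : ∀ x y, w x y = 1 → x ≠ y := by
    rintro x _ hxy rfl
    rw [hw.2.2] at hxy
    omega
  have two_of_ne : ∀ x ∈ K, ∀ y ∈ K, x ≠ y → w x y ≠ 1 → w x y = 2 :=
    fun x hx y hy => h.eq_two_of_ne_one hw hx hy
  let T := {t ∈ K | t ∉ I ∧ #{y ∈ K | w t y = 1} = 1}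
  have hTdef : ∀ t, t ∈ T ↔ t ∈ K ∧ t ∉ I ∧ #{y ∈ K | w t y = 1} = 1 := fun t => by simp [T]
  let S := {x ∈ I | ∃ t ∈ T, w t x = 1}
  have hSdef : ∀ x, x ∈ S ↔ x ∈ I ∧ ∃ t ∈ T, w t x = 1 := fun t => by simp [S]
  have hSI : S ⊆ I := filter_subset _ _
  have hTuniq : ∀ t ∈ T, ∀ x ∈ K, ∀ y ∈ K, w t x = 1 → w t y = 1 → x = y := by
    intro t ht x hx y hy htx hty
    exact card_le_one.1 ((hTdef t).1 ht).2.2.le x (by simp [hx, htx]) y (by simp [hy, hty])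
  have hTS : ∀ t ∈ T, ∀ y ∈ K, w t y = 1 → y ∈ S := by
    intro t ht y hy hty
    obtain ⟨htK, htI, -⟩ := (hTdef t).1 ht
    obtain ⟨x, hx, htx⟩ := h.exists_one_of_notMem hw htK htI
    rw [hTuniq t ht y hy x (h.sub hx) hty htx]
    exact (hSdef x).2 ⟨hx, t, ht, htx⟩
  have hTI : Disjoint T I := disjoint_left.2 fun t ht => ((hTdef t).1 ht).2.1
  have hTK : T ⊆ K := filter_subset _ _
  have hSL : Disjoint S L := disjoint_left.2 fun x hx hxL => by
    obtain ⟨-, t, ht, htx⟩ := (hSdef x).1 hx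
    exact ((hLdef x).1 hxL).2 t (hTK ht) (by rw [hw.1]; exact htx)
  have hTScard : #T ≤ #S := by
    have hle := h.card_red_le (J := T ∪ I \ S)
      (union_subset hTK (sdiff_subset.trans h.sub)) (by
        have key : ∀ t ∈ T, ∀ y ∈ T ∪ I \ S, t ≠ y → w t y = 2 := by
          intro t ht y hy hty
          have hyK : y ∈ K := union_subset hTK (sdiff_subset.trans h.sub) hy
          refine two_of_ne t (hTK ht) y hyK hty fun h1 => ?_
          have hyS := hTS t ht y hyK h1
          rcases mem_union.1 hy with hy | hy
          · exact disjoint_left.1 hTI hy (hSI hyS)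
          · exact (mem_sdiff.1 hy).2 hyS
        intro a ha b hb' hab
        rcases mem_union.1 ha with ha' | ha'
        · exact key a ha' b hb' hab
        rcases mem_union.1 hb' with hb'' | hb''
        · rw [hw.1]; exact key b hb'' a ha hab.symm
        · exact h.red a (mem_sdiff.1 ha').1 b (mem_sdiff.1 hb'').1 hab)
    rw [card_union_of_disjoint (hTI.mono_right sdiff_subset), card_sdiff_of_subset hSI] at hle
    have := card_le_card hSI
    omega
  have hSLcard : #S + #L ≤ #I := by
    rw [← card_union_of_disjoint hSL]
    exact card_le_card (union_subset hSI hLI)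
  let c : V → ℕ := fun x =>
    if x ∈ L then 12 else if x ∈ T ∨ x ∈ S then 8 else if x ∈ I then 9 else 6
  have hcI : ∀ x ∈ I, 8 ≤ c x := fun x hx => by
    simp only [c, hx, if_true]; split_ifs <;> omega
  have hcT : ∀ x ∈ T, 8 ≤ c x := fun x hx => by
    simp only [c, hx, true_or, if_true]; split_ifs <;> omega
  have hc6 : ∀ x, 6 ≤ c x := fun x => by
    simp only [c]; split_ifs <;> omega
  have hc9 : ∀ x ∈ I, x ∉ S → 9 ≤ c x := fun x hx hxS => by
    have hxT : x ∉ T := fun ht => disjoint_left.1 hTI ht hx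
    simp only [c, hx, hxS, hxT, or_self, if_true, if_false]
    split_ifs <;> omega
  refine ⟨c, fun x _ => hc6 x, ?_, h.deficiency_ge hw c (fun x _ => hc6 x) ?_ ?_ ?_⟩
  · have hsum := sum_ite_add_card_le h.sub hLI hSI hTK hTI hSL
    simp only [c]
    omega
  · intro x hx hxL
    simp only [c, (hLdef x).2 ⟨hx, hxL⟩, if_true, le_refl]
  · intro u hu v hv
    have hv0 : ∀ y ∈ K, y ≠ u → w v y ≠ 0 := fun y hy hyu => by rw [hv y hy hyu]; omega
    have huI : u ∈ I := by
      by_contra huI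
      obtain ⟨y, hy, hvy⟩ := h.exists_one_mem_red hw hu hv0 (subset_erase.2 ⟨h.sub, huI⟩)
        h.red rfl
      rw [hv y (h.sub hy) (fun e => huI (e ▸ hy))] at hvy
      omega
    have hvI : v ∉ I.erase u := fun hm => by
      have := hv v (h.sub (mem_of_mem_erase hm)) (ne_of_mem_erase hm)
      rw [hw.2.2] at this
      omega
    have hle := h.card_one_le hw hu hv0 (J := insert v (I.erase u))
      (insert_subset_insert _ (erase_subset_erase _ h.sub))
      (hw.forall_insert (· = 2)
        (fun y hy _ => hv y (h.sub (mem_of_mem_erase hy)) (ne_of_mem_erase hy))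
        fun a ha b hb => h.red a (mem_of_mem_erase ha) b (mem_of_mem_erase hb))
      (by rw [card_insert_of_notMem hvI, card_erase_add_one huI])
    have hzero : {y ∈ K.erase u | w v y = 1} = ∅ := by
      refine filter_eq_empty_iff.2 fun y hy h1 => ?_
      rw [hv y (mem_of_mem_erase hy) (ne_of_mem_erase hy)] at h1
      omega
    rw [hzero, card_empty, Nat.le_zero, card_eq_zero] at hle
    have huL : u ∈ L := (hLdef u).2 ⟨hu, fun y hy h1 => filter_eq_empty_iff.1 hle hy h1⟩
    simp only [c, huL, if_true, le_refl]
  · intro u hu v u' hu' huu' hvu' hv huL hu'L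
    have hv0 : ∀ y ∈ K, y ≠ u → w v y ≠ 0 := fun y hy hyu => by
      by_cases e : y = u'
      · rw [e, hvu']; omega
      · rw [hv y hy hyu e]; omega
    have hmem : ∀ J : Finset V, J ⊆ K.erase u → (∀ x ∈ J, ∀ y ∈ J, x ≠ y → w x y = 2) →
        #J = #I → u' ∈ J := fun J hJ red hcard => by
      obtain ⟨y, hy, hvy⟩ := h.exists_one_mem_red hw hu hv0 hJ red hcard
      by_cases e : y = u'
      · exact e ▸ hy
      · rw [hv y (mem_of_mem_erase (hJ hy)) (ne_of_mem_erase (hJ hy)) e] at hvy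
        omega
    by_cases huI : u ∈ I
    · by_cases huS : u ∈ S
      · obtain ⟨-, t, ht, htu⟩ := (hSdef u).1 huS
        have htI : t ∉ I := disjoint_left.1 hTI ht
        have ht2 : ∀ y ∈ I.erase u, w t y = 2 := fun y hy =>
          two_of_ne t (hTK ht) y (h.sub (mem_of_mem_erase hy))
            (fun e => htI (e ▸ mem_of_mem_erase hy)) fun h1 =>
              ne_of_mem_erase hy (hTuniq t ht y (h.sub (mem_of_mem_erase hy)) u hu h1 htu)
        have hu'J := hmem (insert t (I.erase u))
          (insert_subset (mem_erase.2 ⟨hself _ _ htu, hTK ht⟩)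
            (erase_subset_erase _ h.sub))
          (hw.forall_insert (· = 2) (fun y hy _ => ht2 y hy)
            fun a ha b hb => h.red a (mem_of_mem_erase ha) b (mem_of_mem_erase hb))
          (by rw [card_insert_of_notMem (fun e => htI (mem_of_mem_erase e)),
                card_erase_add_one huI])
        have h8 : 8 ≤ c u' := by
          rcases mem_insert.1 hu'J with e | hm
          · exact hcT u' (e ▸ ht)
          · exact hcI u' (mem_of_mem_erase hm)
        have := hcI u huI
        omega
      · have := hc9 u huI huS
        have := hc6 u'
        omega
    · have hIK : I ⊆ K.erase u := subset_erase.2 ⟨h.sub, huI⟩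
      have h8 := hcI u' (hmem I hIK h.red rfl)
      have hle := h.card_one_le hw hu hv0 (hIK.trans (subset_insert _ _)) h.red rfl
      have hone : #{y ∈ K.erase u | w v y = 1} ≤ 1 := by
        refine (card_le_card (t := {u'}) fun y hy => ?_).trans_eq (card_singleton u')
        obtain ⟨hy, hvy⟩ := mem_filter.1 hy
        rw [mem_singleton]
        by_contra e
        rw [hv y (mem_of_mem_erase hy) (ne_of_mem_erase hy) e] at hvy
        omega
      have hpos : 0 < #{y ∈ K | w u y = 1} := by
        obtain ⟨y, hy, huy⟩ := huL
        exact card_pos.2 ⟨y, mem_filter.2 ⟨hy, huy⟩⟩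
      have := hcT u ((hTdef u).2 ⟨hu, huI, by omega⟩)
      omega

theorem exists_weighting_of_lt_two (h : OptimalPair w m K I) (hw : IsColoured w)
    {L : Finset V} (hLdef : ∀ x, x ∈ L ↔ x ∈ K ∧ ∀ y ∈ K, w x y ≠ 1) (hLI : L ⊆ I)
    (hLlt : #L < #I) (hb : #I < #L + 2) (hKI : #I + 2 ≤ #K) :
    ∃ c : V → ℕ, (∀ x ∈ K, 6 ≤ c x) ∧ ∑ x ∈ K, c x + 4 ≤ 6 * (#K + #I) ∧
      ∀ v, 24 ≤ ∑ y ∈ K, c y * (2 - w v y) := by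
  have two_of_ne : ∀ x ∈ K, ∀ y ∈ K, x ≠ y → w x y ≠ 1 → w x y = 2 :=
    fun x hx y hy => h.eq_two_of_ne_one hw hx hy
  have hmax : ∀ z ∈ K, z ∉ L → ∀ x ∈ insert z L, ∀ y ∈ insert z L, x ≠ y → w x y = 2 := by
    have h2 : ∀ x ∈ L, ∀ y ∈ K, x ≠ y → w x y = 2 := fun x hx y hy hxy =>
      two_of_ne x (h.sub (hLI hx)) y hy hxy (((hLdef x).1 hx).2 y hy)
    exact fun z hz _ => hw.forall_insert (· = 2)
      (fun y hy hyz => by rw [hw.1]; exact h2 y hy z hz hyz)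
      fun x hx y hy => h2 x hx y (h.sub (hLI hy))
  have havoid : ∀ u ∈ K, u ∉ L → ∀ u' ∉ L, ∀ v, (∀ y ∈ K, y ≠ u → w v y ≠ 0) →
      ∃ y ∈ K, y ≠ u ∧ y ≠ u' ∧ w v y = 1 := by
    intro u hu huL u' hu'L v hv
    obtain ⟨z, hz, hz'⟩ := exists_mem_notMem_of_card_lt_card (s := insert u (insert u' L))
      (t := K) (by
        have := card_insert_le u (insert u' L)
        have := card_insert_le u' L
        omega)
    simp only [mem_insert, not_or] at hz'
    obtain ⟨y, hy, hvy⟩ := h.exists_one_mem_red hw hu hv (J := insert z L)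
      (insert_subset (mem_erase.2 ⟨hz'.1, hz⟩) (subset_erase.2 ⟨hLI.trans h.sub, huL⟩))
      (hmax z hz hz'.2.2) (by rw [card_insert_of_notMem hz'.2.2]; omega)
    refine ⟨y, insert_subset hz (hLI.trans h.sub) hy, ?_, ?_, hvy⟩
    · rintro rfl
      rcases mem_insert.1 hy with e | e
      · exact hz'.1 e.symm
      · exact huL e
    · rintro rfl
      rcases mem_insert.1 hy with e | e
      · exact hz'.2.1 e.symm
      · exact hu'L e
  let c : V → ℕ := fun x => if x ∈ L then 12 else 6
  have hc6 : ∀ x, 6 ≤ c x := fun x => by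
    simp only [c]; split_ifs <;> omega
  refine ⟨c, fun x _ => hc6 x, ?_, h.deficiency_ge hw c (fun x _ => hc6 x) ?_ ?_ ?_⟩
  · have hsum : ∑ x ∈ K, c x = ∑ x ∈ K, (6 + if x ∈ L then 6 else 0) :=
      sum_congr rfl fun x _ => by simp only [c]; split_ifs <;> rfl
    rw [hsum, sum_add_distrib, sum_ite_mem, inter_eq_right.2 (hLI.trans h.sub), sum_const,
      sum_const, smul_eq_mul, smul_eq_mul]
    omega
  · intro x hx hxL
    simp only [c, (hLdef x).2 ⟨hx, hxL⟩, if_true, le_refl]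
  · intro u hu v hv
    by_cases huL : u ∈ L
    · simp only [c, huL, if_true, le_refl]
    obtain ⟨y, hy, hyu, -, hvy⟩ := havoid u hu huL u huL v fun y hy hyu => by
      rw [hv y hy hyu]; omega
    rw [hv y hy hyu] at hvy
    omega
  · intro u hu v u' hu' huu' hvu' hv ⟨a, ha, hua⟩ ⟨b, hb', hub⟩
    obtain ⟨y, hy, hyu, hyu', hvy⟩ := havoid u hu (fun e => ((hLdef u).1 e).2 a ha hua) u'
      (fun e => ((hLdef u').1 e).2 b hb' hub) v fun y hy hyu => by
        by_cases e : y = u'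
        · rw [e, hvu']; omega
        · rw [hv y hy hyu e]; omega
    rw [hv y hy hyu hyu'] at hvy
    omega

theorem exists_weighting (h : OptimalPair w m K I) (hw : IsColoured w) (hKI : #I + 2 ≤ #K) :
    ∃ c : V → ℕ, (∀ x ∈ K, 6 ≤ c x) ∧ ∑ x ∈ K, c x + 4 ≤ 6 * (#K + #I) ∧
      ∀ v, 24 ≤ ∑ y ∈ K, c y * (2 - w v y) := by
  let L := {x ∈ K | ∀ y ∈ K, w x y ≠ 1}
  have hLdef : ∀ x, x ∈ L ↔ x ∈ K ∧ ∀ y ∈ K, w x y ≠ 1 := fun x => by simp [L]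
  have hLI : L ⊆ I := fun x hx => by
    by_contra hxI
    obtain ⟨hxK, hx⟩ := (hLdef x).1 hx
    obtain ⟨y, hy, hxy⟩ := h.exists_one_of_notMem hw hxK hxI
    exact hx y (h.sub hy) hxy
  obtain ⟨z₀, hz₀K, hz₀I⟩ := exists_mem_notMem_of_card_lt_card (s := I) (t := K) (by omega)
  obtain ⟨x₀, hx₀I, hx₀⟩ := h.exists_one_of_notMem hw hz₀K hz₀I
  have hx₀L : x₀ ∉ L := fun hx => ((hLdef x₀).1 hx).2 z₀ hz₀K (by rw [hw.1]; exact hx₀)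
  have hLlt : #L < #I := card_lt_card ⟨hLI, fun hs => hx₀L (hs hx₀I)⟩
  by_cases hb : #L + 2 ≤ #I
  · exact h.exists_weighting_of_two_le hw hLdef hLI hb
  · exact h.exists_weighting_of_lt_two hw hLdef hLI hLlt (by omega) hKI

end OptimalPair

/-- Double counting: a weighting of total at most `12 r - 4` with deficiency at least `24` at
every vertex forces some vertex to have small degree. -/
theorem false_of_weighting {V : Type*} [Fintype V] (r : ℕ) (hr : 2 ≤ r)
    (w : V → V → ℕ) (hw : IsColoured w)
    (hdeg : ∀ x : V,
      (6 * (r : ℝ) - 8) / (3 * (r : ℝ) - 1) * (Fintype.card V : ℝ) < ∑ y : V, (w x y : ℝ))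
    (K : Finset V) (hK : K.Nonempty) (c : V → ℕ) (hc : ∀ x ∈ K, 6 ≤ c x)
    (hsum : ∑ x ∈ K, c x + 4 ≤ 12 * r) (h24 : ∀ v, 24 ≤ ∑ y ∈ K, c y * (2 - w v y)) :
    False := by
  have hr' : (2 : ℝ) ≤ r := by exact_mod_cast hr
  set n : ℝ := (Fintype.card V : ℝ) with hn
  have hpos : (0 : ℝ) < 3 * r - 1 := by linarith
  have hne : 3 * (r : ℝ) - 1 ≠ 0 := hpos.ne'
  have hv : ∀ v, (24 : ℝ) ≤ ∑ y ∈ K, (c y : ℝ) * (2 - w y v) := fun v => by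
    have h := h24 v
    have hcast : ((∑ y ∈ K, c y * (2 - w v y) : ℕ) : ℝ) = ∑ y ∈ K, (c y : ℝ) * (2 - w y v) := by
      push_cast
      refine sum_congr rfl fun y _ => ?_
      rw [Nat.cast_sub (hw.2.1 v y), hw.1 v y]
      norm_num
    rw [← hcast]
    exact_mod_cast h
  have h1 : 24 * n ≤ ∑ y ∈ K, (c y : ℝ) * (2 * n - ∑ v, (w y v : ℝ)) := by
    calc 24 * n = ∑ _v : V, (24 : ℝ) := by simp [hn, mul_comm]
      _ ≤ ∑ v, ∑ y ∈ K, (c y : ℝ) * (2 - w y v) := sum_le_sum fun v _ => hv v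
      _ = _ := by
        rw [sum_comm]
        refine sum_congr rfl fun y _ => ?_
        rw [← mul_sum, sum_sub_distrib]
        simp [hn, mul_comm]
  have h2 : ∑ y ∈ K, (c y : ℝ) * (2 * n - ∑ v, (w y v : ℝ)) <
      ∑ y ∈ K, (c y : ℝ) * (6 / (3 * r - 1) * n) := by
    refine sum_lt_sum_of_nonempty hK fun y hy => ?_
    have hcy : (0 : ℝ) < c y := by
      have := hc y hy
      exact_mod_cast (by omega : 0 < c y)
    refine mul_lt_mul_of_pos_left ?_ hcy
    have hd := hdeg y
    have he : (6 * (r : ℝ) - 8) / (3 * r - 1) * n = 2 * n - 6 / (3 * r - 1) * n := by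
      linear_combination 2 * n * mul_inv_cancel₀ hne
    linarith
  rw [← sum_mul] at h2
  have h3 : (∑ y ∈ K, (c y : ℝ)) ≤ 12 * r - 4 := by
    have : ((∑ x ∈ K, c x + 4 : ℕ) : ℝ) ≤ ((12 * r : ℕ) : ℝ) := by exact_mod_cast hsum
    push_cast at this
    linarith
  have hn0 : 0 ≤ 6 / (3 * (r : ℝ) - 1) * n := by positivity
  have h4 := mul_le_mul_of_nonneg_right h3 hn0
  have h5 : (12 * (r : ℝ) - 4) * (6 / (3 * r - 1) * n) = 24 * n := by
    linear_combination 4 * n * div_mul_cancel₀ (6 : ℝ) hne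
  linarith

/-- Lemma: for `r ≥ 2`, every `𝓕_{2r+1}`-free coloured graph on `n` vertices with minimum
degree greater than `((6r-8)/(3r-1))·n` is `BK_{r+1}`-free. -/
theorem odd_no_blue_clique {V : Type*} [Fintype V] (r : ℕ) (hr : 2 ≤ r)
    (w : V → V → ℕ) (hG : IsColoured w) (hfree : FamFree w (2 * r + 1))
    (hdeg : ∀ x : V,
      (6 * (r : ℝ) - 8) / (3 * (r : ℝ) - 1) * (Fintype.card V : ℝ) < ∑ y : V, (w x y : ℝ)) :
    ¬ HasSub w (BK (r + 1)) := by
  rintro ⟨φ, hφ, hle⟩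
  classical
  have hp : CliquePair w (r + 1) (univ.map ⟨φ, hφ⟩) ∅ := by
    refine ⟨empty_subset _, ?_, by simp, by simp⟩
    intro x hx y hy hxy
    obtain ⟨i, -, rfl⟩ := mem_map.1 hx
    obtain ⟨j, -, rfl⟩ := mem_map.1 hy
    have hij : i ≠ j := fun e => hxy (congrArg _ e)
    simpa [BK, hij] using hle i j
  obtain ⟨K, I, h⟩ := hp.exists_optimal
  have hKcard := h.card
  obtain ⟨x, hx⟩ : K.Nonempty := card_pos.1 (by omega)
  have hI : I.Nonempty := by
    have := h.card_red_le (J := {x}) (by simpa using hx) (by simp)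
    exact card_pos.1 (by simpa using this)
  have hKI := h.card_add_card_le (by omega) hfree hI
  obtain ⟨c, hc, hsum, h24⟩ := h.exists_weighting hG (by omega)
  exact false_of_weighting r hr w hG hdeg K ⟨x, hx⟩ c hc (by omega) h24
end

section
/- For every integer r ≥ 3, every 𝓕_{2r}-free coloured graph G on n vertices with δ(G) > ((14r−24)/(7r−5))·n is BK_{r+1}-free. (In fact the weaker hypothesis δ(G) > (2 − 12/(6r−5))·n already suffices.) -/
section

open Finset

variable {V : Type*} {w : V → V → ℕ}

/-- `K` is a clique: any two distinct vertices of `K` are joined by a blue or red edge. -/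
def IsWeightClique (w : V → V → ℕ) (K : Finset V) : Prop :=
  ∀ x ∈ K, ∀ y ∈ K, x ≠ y → 1 ≤ w x y

/-- `R` is a red clique: any two distinct vertices of `R` are joined by a red edge. -/
def IsRedClique (w : V → V → ℕ) (R : Finset V) : Prop :=
  ∀ x ∈ R, ∀ y ∈ R, x ≠ y → w x y = 2

/-- The number of blue neighbours of `x` in `K`. -/
def blueDegree (w : V → V → ℕ) (K : Finset V) (x : V) : ℕ := #{u ∈ K | w u x = 1}

/-- Twice the number of blue edges inside `K`. -/
def blueCount (w : V → V → ℕ) (K : Finset V) : ℕ := ∑ x ∈ K, blueDegree w K x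

theorem IsRedClique.mono {R S : Finset V} (hS : IsRedClique w S) (h : R ⊆ S) :
    IsRedClique w R :=
  fun x hx y hy => hS x (h hx) y (h hy)

theorem IsWeightClique.mono {K L : Finset V} (hL : IsWeightClique w L) (h : K ⊆ L) :
    IsWeightClique w K :=
  fun x hx y hy => hL x (h hx) y (h hy)

theorem IsRedClique.insert [DecidableEq V] (hw : IsColoured w) {R : Finset V} {y : V}
    (hR : IsRedClique w R) (hy : ∀ u ∈ R, w u y = 2) : IsRedClique w (insert y R) := by
  intro a ha b hb hab
  rw [mem_insert] at ha hb
  rcases ha with rfl | ha <;> rcases hb with rfl | hb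
  · exact absurd rfl hab
  · rw [hw.1, hy b hb]
  · exact hy a ha
  · exact hR a ha b hb hab

theorem IsWeightClique.insert [DecidableEq V] (hw : IsColoured w) {K : Finset V} {y : V}
    (hK : IsWeightClique w K) (hy : ∀ u ∈ K, 1 ≤ w u y) : IsWeightClique w (insert y K) := by
  intro a ha b hb hab
  rw [mem_insert] at ha hb
  rcases ha with rfl | ha <;> rcases hb with rfl | hb
  · exact absurd rfl hab
  · rw [hw.1]; exact hy b hb
  · exact hy a ha
  · exact hK a ha b hb hab

theorem blueDegree_insert [DecidableEq V] {L : Finset V} {y : V} (hy : y ∉ L) (x : V) :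
    blueDegree w (insert y L) x = blueDegree w L x + if w y x = 1 then 1 else 0 := by
  unfold blueDegree
  rw [filter_insert]
  split_ifs with h
  · rw [card_insert_of_notMem (by simp [hy])]
  · rfl

theorem blueCount_insert [DecidableEq V] (hw : IsColoured w) {L : Finset V} {y : V}
    (hy : y ∉ L) : blueCount w (insert y L) = blueCount w L + 2 * blueDegree w L y := by
  have hyy := hw.2.2 y
  have h : ∑ x ∈ L, (if w y x = 1 then 1 else 0) = blueDegree w L y := by
    unfold blueDegree
    rw [card_filter]
    exact sum_congr rfl fun x _ => by rw [hw.1]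
  unfold blueCount
  rw [sum_insert hy]
  simp only [blueDegree_insert hy]
  rw [sum_add_distrib, h, hyy]
  simp
  ring

theorem blueDegree_erase [DecidableEq V] {K : Finset V} {v x : V} (h : w v x = 0) :
    blueDegree w (K.erase v) x = blueDegree w K x := by
  unfold blueDegree
  congr 1
  ext u
  simp only [mem_filter, mem_erase]
  constructor
  · tauto
  · rintro ⟨hu, hux⟩
    exact ⟨⟨fun e => by subst e; omega, hu⟩, hux⟩

/-- Exchanging `v` for a vertex `y` whose only non-neighbour in `K` is `v`. -/
theorem blueCount_swap [DecidableEq V] (hw : IsColoured w) {K : Finset V} {v y : V}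
    (hv : v ∈ K) (hvy : w v y = 0) (hy : y ∉ K.erase v) :
    blueCount w (insert y (K.erase v)) + 2 * blueDegree w K v =
      blueCount w K + 2 * blueDegree w K y := by
  have h1 := blueCount_insert hw hy
  have h2 := blueCount_insert hw (notMem_erase v K)
  rw [insert_erase hv] at h2
  rw [blueDegree_erase hvy] at h1
  rw [blueDegree_erase (hw.2.2 v)] at h2
  omega

theorem eq_two_of_ne_one (hw : IsColoured w) {x y : V} (h : 1 ≤ w x y) (h' : w x y ≠ 1) :
    w x y = 2 := by
  have := hw.2.1 x y
  omega

/-- A clique `K` containing a red clique `R` with `|K| + |R| = t` contains `G_{t,|R|}`. -/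
theorem hasSub_Gt_of_card [DecidableEq V] {K R : Finset V} {t : ℕ} (hRK : R ⊆ K)
    (hK : IsWeightClique w K) (hR : IsRedClique w R) (hcard : #K + #R = t) :
    HasSub w (Gt t #R) := by
  have hRle := card_le_card hRK
  have hS : #(K \ R) = t - #R - #R := by
    rw [card_sdiff_of_subset hRK]; omega
  let eR := R.equivFin.symm
  let eS := (K \ R).equivFin.symm
  have hlt : ∀ x : Fin (t - #R), ¬ x.val < #R → x.val - #R < #(K \ R) := fun x hx => by
    have := x.2; omega
  let φ : Fin (t - #R) → V := fun x =>
    if h : x.val < #R then (eR ⟨x.val, h⟩ : V) else (eS ⟨x.val - #R, hlt x h⟩ : V)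
  have hφR : ∀ x, x.val < #R → φ x ∈ R := fun x h => by
    simp only [φ, dif_pos h]; exact (eR _).2
  have hφS : ∀ x, ¬ x.val < #R → φ x ∈ K \ R := fun x h => by
    simp only [φ, dif_neg h]; exact (eS _).2
  have hφK : ∀ x, φ x ∈ K := fun x => by
    by_cases h : x.val < #R
    · exact hRK (hφR x h)
    · exact (mem_sdiff.1 (hφS x h)).1
  have hinj : Function.Injective φ := by
    intro x y hxy
    by_cases hx : x.val < #R <;> by_cases hy : y.val < #R
    · simp only [φ, dif_pos hx, dif_pos hy] at hxy
      have := eR.injective (Subtype.ext hxy)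
      exact Fin.ext (by simpa using this)
    · exact absurd (hxy ▸ hφR x hx) (mem_sdiff.1 (hφS y hy)).2
    · exact absurd (hxy ▸ hφR y hy) (mem_sdiff.1 (hφS x hx)).2
    · simp only [φ, dif_neg hx, dif_neg hy] at hxy
      have := eS.injective (Subtype.ext hxy)
      simp only [Fin.mk.injEq] at this
      exact Fin.ext (by omega)
  refine ⟨φ, hinj, fun x y => ?_⟩
  unfold Gt
  split_ifs with h h'
  · exact Nat.zero_le _
  · exact (hR _ (hφR x h'.1) _ (hφR y h'.2) (hinj.ne h)).ge
  · exact hK _ (hφK x) _ (hφK y) (hinj.ne h)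

theorem FamFree.card_add_card_lt {r : ℕ} (hr : 1 ≤ r) (hF : FamFree w (2 * r))
    {K R : Finset V} (hRK : R ⊆ K) (hK : IsWeightClique w K) (hR : IsRedClique w R)
    (hpos : 1 ≤ #R) : #K + #R < 2 * r := by
  classical
  by_contra! hcon
  have hRle := card_le_card hRK
  obtain ⟨R', hR'R, hR'⟩ := exists_subset_card_eq (s := R) (n := min #R r) (min_le_left _ _)
  obtain ⟨K', hR'K', hK'K, hK'⟩ := exists_subsuperset_card_eq (n := 2 * r - #R')
    (hR'R.trans hRK) (by omega) (by omega)
  exact hF #R' (by omega) (by omega)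
    (hasSub_Gt_of_card hR'K' (hK.mono hK'K) (hR.mono hR'R) (by omega))

/-- Averaging: some vertex has small weighted deficiency into `K`. -/
theorem exists_deficiency_lt_two [Fintype V] {r : ℕ} (hr : 1 ≤ r)
    (hdeg : ∀ x : V, (2 - 12 / (6 * (r : ℝ) - 5)) * (Fintype.card V : ℝ)
      < ∑ y : V, (w x y : ℝ))
    {K : Finset V} (hK : K.Nonempty) {a : V → ℝ} (ha : ∀ v ∈ K, 1 / 2 ≤ a v)
    (hsum : ∑ v ∈ K, a v ≤ r - 5 / 6) :
    ∃ y, ∑ v ∈ K, a v * (2 - w v y) < 2 := by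
  by_contra! hcon
  have hr' : (1 : ℝ) ≤ r := by exact_mod_cast hr
  have hc : (0 : ℝ) < 6 * r - 5 := by linarith
  set n : ℝ := (Fintype.card V : ℝ) with hn
  have h1 : 2 * n ≤ ∑ y : V, ∑ v ∈ K, a v * (2 - w v y) := by
    have := sum_le_sum fun (y : V) (_ : y ∈ univ) => hcon y
    simpa [hn, mul_comm] using this
  rw [sum_comm] at h1
  have h2 : ∑ v ∈ K, ∑ y : V, a v * (2 - w v y) < ∑ v ∈ K, a v * (12 / (6 * r - 5) * n) := by
    refine sum_lt_sum_of_nonempty hK fun v hv => ?_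
    rw [← mul_sum, sum_sub_distrib]
    have := hdeg v
    have hav := ha v hv
    refine mul_lt_mul_of_pos_left ?_ (by linarith)
    simp only [sum_const, card_univ, nsmul_eq_mul]
    linarith
  rw [← sum_mul] at h2
  have h3 : (∑ v ∈ K, a v) * (12 / (6 * r - 5) * n) ≤ (r - 5 / 6) * (12 / (6 * r - 5) * n) := by
    gcongr
  have h4 : (r - 5 / 6 : ℝ) * (12 / (6 * r - 5) * n) = 2 * n := by
    calc (r - 5 / 6 : ℝ) * (12 / (6 * r - 5) * n)
        = 2 * ((6 * r - 5) / (6 * r - 5)) * n := by ring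
      _ = 2 * n := by rw [div_self hc.ne', mul_one]
  linarith

/-- A vertex of small deficiency into a maximum clique `K` has exactly one non-neighbour. -/
theorem exists_unique_nonneighbor (hw : IsColoured w) {K : Finset V}
    (hK : IsWeightClique w K) (hmax : ∀ K', IsWeightClique w K' → #K' ≤ #K)
    {a : V → ℝ} (ha : ∀ v ∈ K, 1 / 2 ≤ a v) {y : V}
    (hy : ∑ v ∈ K, a v * (2 - w v y) < 2) :
    ∃ v ∈ K, w v y = 0 ∧ (∀ u ∈ K, u ≠ v → 1 ≤ w u y) ∧
      2 * a v + ∑ u ∈ K with w u y = 1, a u < 2 := by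
  classical
  have hnn : ∀ u ∈ K, 0 ≤ a u * (2 - w u y) := fun u hu => by
    have h1 := ha u hu
    have h2 : (w u y : ℝ) ≤ 2 := by exact_mod_cast hw.2.1 u y
    exact mul_nonneg (by linarith) (by linarith)
  obtain ⟨v, hv, hvy⟩ : ∃ v ∈ K, w v y = 0 := by
    by_contra! hcon
    have hyK : y ∉ K := fun h => hcon y h (hw.2.2 y)
    have := hmax _ (hK.insert hw (y := y) fun u hu => Nat.one_le_iff_ne_zero.2 (hcon u hu))
    rw [card_insert_of_notMem hyK] at this
    omega
  rw [← add_sum_erase _ _ hv, hvy] at hy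
  have hsum : ∑ u ∈ K with w u y = 1, a u ≤ ∑ u ∈ K.erase v, a u * (2 - w u y) := by
    have hsub : K.filter (fun u => w u y = 1) ⊆ K.erase v := fun u hu => by
      rw [mem_filter] at hu
      exact mem_erase.2 ⟨fun e => by subst e; omega, hu.1⟩
    calc ∑ u ∈ K with w u y = 1, a u
        = ∑ u ∈ K with w u y = 1, a u * (2 - w u y) := by
          refine sum_congr rfl fun u hu => ?_
          rw [(mem_filter.1 hu).2]
          norm_num
      _ ≤ _ := sum_le_sum_of_subset_of_nonneg hsub fun u hu _ => hnn u (mem_of_mem_erase hu)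
  refine ⟨v, hv, hvy, fun u hu huv => ?_, ?_⟩
  · by_contra! h0
    have h1 := single_le_sum (fun x hx => hnn x (mem_of_mem_erase hx))
      (mem_erase.2 ⟨huv, hu⟩)
    have h2 : w u y = 0 := by omega
    rw [h2] at h1
    have h3 := ha u hu
    have h4 := ha v hv
    push_cast at h1 hy
    linarith
  · push_cast at hy
    linarith

/-- A red clique is an independent set of the blue graph on `K`. Isolated vertices count fully
and vertices of degree one by half; a vertex of degree at least two gives one more vertex. -/
theorem exists_isRedClique_card (hw : IsColoured w) {K : Finset V} (hK : IsWeightClique w K) :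
    ∃ R ⊆ K, IsRedClique w R ∧
      2 * #{x ∈ K | blueDegree w K x = 0} + #{x ∈ K | blueDegree w K x = 1} +
        (if ∃ x ∈ K, 2 ≤ blueDegree w K x then 2 else 0) ≤ 2 * #R := by
  classical
  set Y := K.filter fun x => blueDegree w K x = 0 with hY
  set P := K.filter fun x => blueDegree w K x = 1 with hP
  have hpair : ∀ x ∈ K, ∀ y ∈ K, x ≠ y → w x y ≠ 1 → w x y = 2 := fun x hx y hy hxy h =>
    eq_two_of_ne_one hw (hK x hx y hy hxy) h
  have hdeg0 : ∀ x ∈ Y, ∀ u ∈ K, w u x ≠ 1 := fun x hx u hu h => by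
    have h0 := (mem_filter.1 hx).2
    rw [blueDegree, card_eq_zero] at h0
    exact notMem_empty u (h0 ▸ mem_filter.2 ⟨hu, h⟩)
  have hdeg1 : ∀ x ∈ P, ∀ u ∈ K, ∀ u' ∈ K, w u x = 1 → w u' x = 1 → u = u' :=
    fun x hx u hu u' hu' h h' =>
      card_le_one.1 (mem_filter.1 hx).2.le u (mem_filter.2 ⟨hu, h⟩) u' (mem_filter.2 ⟨hu', h'⟩)
  have hYP : Disjoint Y P := disjoint_filter.2 fun x _ h => by omega
  obtain ⟨I, hI, hImax⟩ := exists_max_image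
    ((Y ∪ P).powerset.filter (IsRedClique w)) card
    ⟨∅, by simp [IsRedClique]⟩
  simp only [mem_filter, mem_powerset] at hI hImax
  obtain ⟨hIsub, hIred⟩ := hI
  have hYK : Y ⊆ K := filter_subset _ _
  have hPK : P ⊆ K := filter_subset _ _
  have hYPK : Y ∪ P ⊆ K := union_subset hYK hPK
  have hIK : I ⊆ K := hIsub.trans hYPK
  have hnbr : ∀ z ∈ Y ∪ P, z ∉ I → ∃ x ∈ I, w x z = 1 := by
    intro z hz hzI
    by_contra! hcon
    have h1 : IsRedClique w (insert z I) := hIred.insert hw fun u hu =>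
      hpair u (hIK hu) z (hYPK hz) (fun e => hzI (e ▸ hu)) (hcon u hu)
    have := hImax _ ⟨insert_subset hz hIsub, h1⟩
    rw [card_insert_of_notMem hzI] at this
    omega
  have hIP : ∀ x ∈ I, ∀ u ∈ K, w x u = 1 → x ∈ P := fun x hx u hu h => by
    rcases mem_union.1 (hIsub hx) with h' | h'
    · exact absurd (hw.1 x u ▸ h) (hdeg0 x h' u hu)
    · exact h'
  have hYI : Y ⊆ I := fun x hx => by
    by_contra hxI
    obtain ⟨u, hu, hux⟩ := hnbr x (mem_union_left _ hx) hxI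
    exact hdeg0 x hx u (hIK hu) hux
  have hJP : P \ I ⊆ P := sdiff_subset
  have hJnbr : ∀ z ∈ P \ I, ∃ x ∈ I, w x z = 1 := fun z hz =>
    hnbr z (mem_union_right _ (mem_sdiff.1 hz).1) (mem_sdiff.1 hz).2
  choose! g hgI hg using hJnbr
  have hcount : ∀ X ⊆ I ∩ P, (∀ x ∈ X, ∀ z ∈ P \ I, w x z ≠ 1) →
      2 * #Y + #P + #X ≤ 2 * #I := by
    intro X hX hXn
    have h1 : #(P \ I) ≤ #((I ∩ P) \ X) := by
      refine card_le_card_of_injOn g (fun z hz => ?_) fun z hz z' hz' e => ?_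
      · have hzK := hPK (hJP hz)
        exact mem_sdiff.2 ⟨mem_inter.2 ⟨hgI z hz, hIP _ (hgI z hz) z hzK (hg z hz)⟩,
          fun h => hXn _ h z hz (hg z hz)⟩
      · have hzK := hPK (hJP hz)
        have hzK' := hPK (hJP hz')
        refine hdeg1 (g z) (hIP _ (hgI z hz) z hzK (hg z hz)) z hzK z' hzK' ?_ ?_
        · rw [hw.1]; exact hg z hz
        · rw [hw.1, e]; exact hg z' hz'
    rw [card_sdiff_of_subset hX] at h1
    have h2 := card_le_card hX
    have h3 : #(P \ I) + #(I ∩ P) = #P := by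
      rw [inter_comm]; exact card_sdiff_add_card_inter P I
    have h4 : #I = #Y + #(I ∩ P) := by
      rw [← card_union_of_disjoint (hYP.mono_right inter_subset_right)]
      congr 1
      ext x
      simp only [mem_union, mem_inter]
      constructor
      · intro hx
        have := mem_union.1 (hIsub hx)
        tauto
      · rintro (hx | hx)
        · exact hYI hx
        · exact hx.1
    omega
  split_ifs with hQ
  · obtain ⟨q, hqK, hq⟩ := hQ
    by_cases hfree : ∃ q ∈ K, 2 ≤ blueDegree w K q ∧ ∀ x ∈ I, w x q ≠ 1
    · obtain ⟨q, hqK, hq, hqI⟩ := hfree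
      have hqn : q ∉ I := fun h => by
        rcases mem_union.1 (hIsub h) with h' | h' <;> have := (mem_filter.1 h').2 <;> omega
      refine ⟨insert q I, insert_subset hqK hIK, hIred.insert hw fun u hu =>
        hpair u (hIK hu) q hqK (fun e => hqn (e ▸ hu)) (hqI u hu), ?_⟩
      have := hcount ∅ (empty_subset _) (by simp)
      rw [card_insert_of_notMem hqn]
      simp only [card_empty] at this
      omega
    · push Not at hfree
      refine ⟨I, hIK, hIred, ?_⟩
      have hqnP : ∀ q, 2 ≤ blueDegree w K q → q ∉ P := fun q hq h => by
        have := (mem_filter.1 h).2; omega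
      have hqnI : ∀ q, 2 ≤ blueDegree w K q → q ∉ I := fun q hq h => by
        rcases mem_union.1 (hIsub h) with h' | h' <;> have := (mem_filter.1 h').2 <;> omega
      -- a neighbour of `q` lies in `I` or has high degree; either way it determines a leaf in `I`
      have key : ∀ z ∈ K, w z q = 1 → ∃ x ∈ I, ∃ q' ∈ K, 2 ≤ blueDegree w K q' ∧
          w x q' = 1 ∧ (x = z ∧ q' = q ∨ q' = z ∧ z ∉ I) := by
        intro z hz hzq
        by_cases hzI : z ∈ I
        · exact ⟨z, hzI, q, hqK, hq, hzq, Or.inl ⟨rfl, rfl⟩⟩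
        have hz2 : 2 ≤ blueDegree w K z := by
          by_contra! hlt
          have hzYP : z ∈ Y ∪ P := by
            simp only [hY, hP, mem_union, mem_filter, hz, true_and]
            omega
          obtain ⟨x, hx, hxz⟩ := hnbr z hzYP hzI
          rcases mem_union.1 hzYP with h' | h'
          · exact hdeg0 z h' x (hIK hx) hxz
          · have := hdeg1 z h' x (hIK hx) q hqK hxz (by rw [hw.1]; exact hzq)
            exact hqnI q hq (this ▸ hx)
        obtain ⟨x, hx, hxz⟩ := hfree z hz hz2
        exact ⟨x, hx, z, hz, hz2, hxz, Or.inr ⟨rfl, hzI⟩⟩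
      obtain ⟨z₁, hz₁, z₂, hz₂, hne⟩ := one_lt_card.1 (show 1 < #{u ∈ K | w u q = 1} from hq)
      rw [mem_filter] at hz₁ hz₂
      obtain ⟨x₁, hx₁, q₁, hq₁K, hq₁, hxq₁, h₁⟩ := key z₁ hz₁.1 hz₁.2
      obtain ⟨x₂, hx₂, q₂, hq₂K, hq₂, hxq₂, h₂⟩ := key z₂ hz₂.1 hz₂.2
      have hleaf : ∀ x ∈ I, ∀ q' ∈ K, ∀ u ∈ K, w x q' = 1 → w x u = 1 → u = q' :=
        fun x hx q' hq' u hu h h' => hdeg1 x (hIP x hx q' hq' h) u hu q' hq'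
          (by rw [hw.1]; exact h') (by rw [hw.1]; exact h)
      have hqz : ∀ z, w z q = 1 → z ≠ q := fun z h e => by
        have := hw.2.2 q; rw [e] at h; omega
      have hx12 : x₁ ≠ x₂ := by
        intro e
        have h12 : q₂ = q₁ := hleaf x₁ hx₁ q₁ hq₁K q₂ hq₂K hxq₁ (e ▸ hxq₂)
        have := hqz z₁ hz₁.2
        have := hqz z₂ hz₂.2
        rcases h₁ with ⟨e1, e2⟩ | ⟨e1, e2⟩ <;> rcases h₂ with ⟨e3, e4⟩ | ⟨e3, e4⟩ <;> grind
      have := hcount {x₁, x₂} ?_ ?_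
      · rwa [card_pair hx12] at this
      · intro x hx
        rw [mem_insert, mem_singleton] at hx
        rcases hx with rfl | rfl
        · exact mem_inter.2 ⟨hx₁, hIP _ hx₁ q₁ hq₁K hxq₁⟩
        · exact mem_inter.2 ⟨hx₂, hIP _ hx₂ q₂ hq₂K hxq₂⟩
      · intro x hx z hz h
        rw [mem_insert, mem_singleton] at hx
        have hzP := hJP hz
        rcases hx with rfl | rfl
        · exact hqnP q₁ hq₁ (hleaf _ hx₁ q₁ hq₁K z (hPK hzP) hxq₁ h ▸ hzP)
        · exact hqnP q₂ hq₂ (hleaf _ hx₂ q₂ hq₂K z (hPK hzP) hxq₂ h ▸ hzP)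
  · refine ⟨I, hIK, hIred, ?_⟩
    simpa using hcount ∅ (empty_subset _) (by simp)

theorem exists_extremal_clique [Fintype V] (w : V → V → ℕ) :
    ∃ K R : Finset V, IsWeightClique w K ∧ (∀ K', IsWeightClique w K' → #K' ≤ #K) ∧
      (∀ K', IsWeightClique w K' → #K' = #K → blueCount w K ≤ blueCount w K') ∧
      R ⊆ K ∧ IsRedClique w R ∧
      ∀ K' R', IsWeightClique w K' → #K' = #K → blueCount w K' = blueCount w K →
        R' ⊆ K' → IsRedClique w R' → #R' ≤ #R := by
  classical
  obtain ⟨K₁, h₁, hmax₁⟩ := exists_max_image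
    ((univ : Finset (Finset V)).filter (IsWeightClique w)) card ⟨∅, by simp [IsWeightClique]⟩
  obtain ⟨K₂, h₂, hmin₂⟩ := exists_min_image
    ((univ : Finset (Finset V)).filter fun K => IsWeightClique w K ∧ #K = #K₁) (blueCount w)
    ⟨K₁, by simpa using h₁⟩
  simp only [mem_filter, mem_univ, true_and] at h₁ hmax₁ h₂ hmin₂
  obtain ⟨⟨K, R⟩, h₃, hmax₃⟩ := exists_max_image
    ((univ : Finset (Finset V × Finset V)).filter fun p => IsWeightClique w p.1 ∧
      #p.1 = #K₁ ∧ blueCount w p.1 = blueCount w K₂ ∧ p.2 ⊆ p.1 ∧ IsRedClique w p.2)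
    (fun p => #p.2) ⟨(K₂, ∅), mem_filter.2
      ⟨mem_univ _, h₂.1, h₂.2, rfl, empty_subset _, by simp [IsRedClique]⟩⟩
  simp only [mem_filter, mem_univ, true_and, Prod.forall] at h₃ hmax₃
  obtain ⟨hK, hcard, hblue, hRK, hR⟩ := h₃
  refine ⟨K, R, hK, ?_, ?_, hRK, hR, ?_⟩
  · rwa [hcard]
  · rw [hcard, hblue]
    exact fun K' hK' hc => hmin₂ K' ⟨hK', hc⟩
  · rw [hcard, hblue]
    exact fun K' R' hK' hc hb hs hR' => hmax₃ K' R' ⟨hK', hc, hb, hs, hR'⟩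

theorem card_le_of_famFree [Fintype V] {r : ℕ} (hr : 1 ≤ r) (hw : IsColoured w)
    (hF : FamFree w (2 * r))
    (hdeg : ∀ x : V, (2 - 12 / (6 * (r : ℝ) - 5)) * (Fintype.card V : ℝ)
      < ∑ y : V, (w x y : ℝ))
    {K₀ : Finset V} (hK₀ : IsWeightClique w K₀) : #K₀ ≤ r := by
  classical
  obtain ⟨K, R, hK, hmax, hmin, hRK, hR, hRmax⟩ := exists_extremal_clique w
  by_contra! hlarge
  replace hlarge : r + 1 ≤ #K := hlarge.trans_le (hmax K₀ hK₀)
  have hne : K.Nonempty := card_pos.1 (by omega)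
  have hRpos : 1 ≤ #R := by
    obtain ⟨x, hx⟩ := hne
    simpa using hRmax K {x} hK rfl rfl (by simpa using hx) (by simp [IsRedClique])
  have hlt := hF.card_add_card_lt hr hRK hK hR hRpos
  -- every admissible weighting yields an exchange
  have hswap : ∀ a : V → ℝ, (∀ v ∈ K, 1 / 2 ≤ a v) → ∑ v ∈ K, a v ≤ r - 5 / 6 →
      ∃ v ∈ K, ∃ y, y ∉ K.erase v ∧ w v y = 0 ∧ (∀ u ∈ K, u ≠ v → 1 ≤ w u y) ∧
        2 * a v + ∑ u ∈ K with w u y = 1, a u < 2 ∧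
        IsWeightClique w (insert y (K.erase v)) ∧ #(insert y (K.erase v)) = #K ∧
        blueDegree w K v ≤ blueDegree w K y := by
    intro a ha hsum
    obtain ⟨y, hy⟩ := exists_deficiency_lt_two hr hdeg hne ha hsum
    obtain ⟨v, hv, hvy, hadj, hdef⟩ := exists_unique_nonneighbor hw hK hmax ha hy
    have hyn : y ∉ K.erase v := fun h => by
      have h1 := hadj y (mem_of_mem_erase h) (ne_of_mem_erase h)
      have h2 := hw.2.2 y
      omega
    have hcl : IsWeightClique w (insert y (K.erase v)) :=
      (hK.mono (erase_subset v K)).insert hw fun u hu =>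
        hadj u (mem_of_mem_erase hu) (ne_of_mem_erase hu)
    have hcard : #(insert y (K.erase v)) = #K := by
      rw [card_insert_of_notMem hyn, card_erase_add_one hv]
    have h1 := blueCount_swap hw hv hvy hyn
    have h2 := hmin _ hcl hcard
    exact ⟨v, hv, y, hyn, hvy, hadj, hdef, hcl, hcard, by omega⟩
  have hcardsum : ∀ y, ∀ a : V → ℝ, ∀ c : ℝ, (∀ v ∈ K, c ≤ a v) →
      c * blueDegree w K y ≤ ∑ u ∈ K with w u y = 1, a u := by
    intro y a c h
    have := card_nsmul_le_sum (K.filter fun u => w u y = 1) a c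
      fun u hu => h u (mem_filter.1 hu).1
    rw [nsmul_eq_mul, mul_comm] at this
    exact this
  have hsum_eq : #K + #R = 2 * r - 1 := by
    by_contra hne2
    have hle : #K + #R + 2 ≤ 2 * r := by omega
    set a : V → ℝ := fun v => if v ∈ R then 1 else 1 / 2 with ha
    have ha2 : ∀ v ∈ K, 1 / 2 ≤ a v := fun v _ => by
      simp only [ha]; split_ifs <;> norm_num
    obtain ⟨v, hv, y, hyn, hvy, hadj, hdef, hcl, hcard, hblue⟩ := hswap a ha2 (by
      have h1 : ∑ v ∈ K, a v = #K / 2 + #R / 2 := by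
        have : ∀ v, a v = 1 / 2 + if v ∈ R then 1 / 2 else 0 := fun v => by
          simp only [ha]; split_ifs <;> norm_num
        simp only [this, sum_add_distrib, sum_ite_mem, inter_eq_right.2 hRK, sum_const,
          nsmul_eq_mul]
        ring
      rw [h1]
      have : (#K + #R + 2 : ℝ) ≤ 2 * r := by exact_mod_cast hle
      linarith)
    have hnn : ∀ u ∈ K.filter (fun u => w u y = 1), 0 ≤ a u := fun u hu => by
      linarith [ha2 u (mem_filter.1 hu).1]
    have hvR : v ∉ R := fun h => by
      have h1 := sum_nonneg hnn
      have h2 : a v = 1 := if_pos h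
      linarith
    have hav : a v = 1 / 2 := if_neg hvR
    have hRy : ∀ u ∈ R, w u y = 2 := fun u hu => by
      refine eq_two_of_ne_one hw (hadj u (hRK hu) fun e => hvR (e ▸ hu)) fun h => ?_
      have h1 := single_le_sum hnn (mem_filter.2 ⟨hRK hu, h⟩)
      have h2 : a u = 1 := if_pos hu
      linarith
    have hB : blueDegree w K y ≤ 1 := by
      have h1 := hcardsum y a (1 / 2) ha2
      have h2 : (blueDegree w K y : ℝ) < 2 := by linarith
      have h3 : blueDegree w K y < 2 := by exact_mod_cast h2
      omega
    have hRe : R ⊆ K.erase v := fun u hu => mem_erase.2 ⟨fun e => hvR (e ▸ hu), hRK hu⟩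
    have hv0 : blueDegree w K v ≠ 0 := fun h0 => by
      have hred : IsRedClique w (insert v R) := hR.insert hw fun u hu => by
        refine eq_two_of_ne_one hw (hK u (hRK hu) v hv fun e => hvR (e ▸ hu)) fun h => ?_
        rw [blueDegree, card_eq_zero] at h0
        exact notMem_empty u (h0 ▸ mem_filter.2 ⟨hRK hu, h⟩)
      have := hRmax K _ hK rfl rfl (insert_subset hv hRK) hred
      rw [card_insert_of_notMem hvR] at this
      omega
    have hbc := blueCount_swap hw hv hvy hyn
    have := hRmax _ (insert y R) hcl hcard (by omega) (insert_subset_insert y hRe)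
      (hR.insert hw hRy)
    rw [card_insert_of_notMem fun h => hyn (hRe h)] at this
    omega
  obtain ⟨R', hR'K, hR', hcount⟩ := exists_isRedClique_card hw hK
  have hR'le : #R' ≤ #R := hRmax K R' hK rfl rfl hR'K ‹_›
  -- weights `1`, `p`, `q` on vertices of blue degree `0`, `1` and at least `2`
  have hweights : ∀ p q : ℝ, 1 / 2 ≤ p → p ≤ 1 → 1 / 2 ≤ q → q ≤ p → 2 ≤ 2 * p + q →
      #K * q + #{x ∈ K | blueDegree w K x = 0} * (1 - q) +
        #{x ∈ K | blueDegree w K x = 1} * (p - q) ≤ (r - 5 / 6 : ℝ) → False := by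
    intro p q hp hp1 hq hqp hpq htot
    set a : V → ℝ := fun v =>
      if blueDegree w K v = 0 then 1 else if blueDegree w K v = 1 then p else q with ha
    have haq : ∀ v ∈ K, q ≤ a v := fun v _ => by
      simp only [ha]; split_ifs <;> linarith
    obtain ⟨v, hv, y, -, -, -, hdef, -, -, hblue⟩ := hswap a
      (fun v hv => hq.trans (haq v hv)) (by
        refine le_of_eq_of_le ?_ htot
        have : ∀ v, a v = q + (if blueDegree w K v = 0 then 1 - q else 0) +
            (if blueDegree w K v = 1 then p - q else 0) := fun v => by
          simp only [ha]
          split_ifs <;> first | omega | ring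
        simp only [this, sum_add_distrib, ← sum_filter, sum_const, nsmul_eq_mul])
    have h1 := hcardsum y a q haq
    have h2 : (blueDegree w K v : ℝ) ≤ blueDegree w K y := by exact_mod_cast hblue
    by_cases hv0 : blueDegree w K v = 0
    · have : a v = 1 := if_pos hv0
      have : 0 ≤ q * blueDegree w K y := by positivity
      linarith
    by_cases hv1 : blueDegree w K v = 1
    · have : a v = p := by simp [ha, hv1]
      rw [hv1] at h2
      push_cast at h2
      nlinarith
    · have : a v = q := by simp [ha, hv0, hv1]
      have h3 : (2 : ℝ) ≤ blueDegree w K v := by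
        have : 2 ≤ blueDegree w K v := by omega
        exact_mod_cast this
      nlinarith
  have hsumR : (#K + #R + 1 : ℝ) = 2 * r := by
    have : #K + #R + 1 = 2 * r := by omega
    exact_mod_cast this
  split_ifs at hcount with hQ
  · refine hweights (3 / 4) (1 / 2) (by norm_num) (by norm_num) (by norm_num) (by norm_num)
      (by norm_num) ?_
    have h : (2 * #{x ∈ K | blueDegree w K x = 0} + #{x ∈ K | blueDegree w K x = 1} + 2 : ℝ) ≤
        2 * #R := by
      exact_mod_cast hcount.trans (by omega)
    linarith
  · refine hweights (2 / 3) (2 / 3) (by norm_num) (by norm_num) (by norm_num) (by norm_num)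
      (by norm_num) ?_
    push Not at hQ
    have hsplit : #{x ∈ K | blueDegree w K x = 0} + #{x ∈ K | blueDegree w K x = 1} = #K := by
      rw [← card_union_of_disjoint (disjoint_filter.2 fun x _ h => by omega), ← filter_or,
        filter_true_of_mem fun x hx => by have := hQ x hx; omega]
    have h : (#{x ∈ K | blueDegree w K x = 0} + #K : ℝ) ≤ 2 * #R := by
      have : #{x ∈ K | blueDegree w K x = 0} + #K ≤ 2 * #R := by omega
      exact_mod_cast this
    have h' : (#R + 3 : ℝ) ≤ #K := by
      have : #R + 3 ≤ #K := by omega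
      exact_mod_cast this
    linarith

theorem not_hasSub_BK [Fintype V] {r : ℕ} (hr : 1 ≤ r) (hw : IsColoured w)
    (hF : FamFree w (2 * r))
    (hdeg : ∀ x : V, (2 - 12 / (6 * (r : ℝ) - 5)) * (Fintype.card V : ℝ)
      < ∑ y : V, (w x y : ℝ)) : ¬ HasSub w (BK (r + 1)) := by
  classical
  rintro ⟨φ, hφ, hle⟩
  have hcl : IsWeightClique w (univ.image φ) := by
    intro x hx y hy hxy
    obtain ⟨i, -, rfl⟩ := mem_image.1 hx
    obtain ⟨j, -, rfl⟩ := mem_image.1 hy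
    have hij : i ≠ j := fun e => hxy (e ▸ rfl)
    simpa [BK, hij] using hle i j
  have := card_le_of_famFree hr hw hF hdeg hcl
  rw [card_image_of_injective _ hφ, card_univ, Fintype.card_fin] at this
  omega

end

/-- Lemma: for `r ≥ 3`, every `𝓕_{2r}`-free coloured graph on `n` vertices with minimum
degree greater than `((14r-24)/(7r-5))·n` is `BK_{r+1}`-free; in fact the weaker minimum
degree hypothesis `δ(G) > (2 - 12/(6r-5))·n` already suffices. -/
theorem even_no_blue_clique :
    (∀ (V : Type u) [Fintype V] (r : ℕ), 3 ≤ r →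
      ∀ w : V → V → ℕ, IsColoured w → FamFree w (2 * r) →
      (∀ x : V, (14 * (r : ℝ) - 24) / (7 * (r : ℝ) - 5) * (Fintype.card V : ℝ)
          < ∑ y : V, (w x y : ℝ)) →
      ¬ HasSub w (BK (r + 1))) ∧
    (∀ (V : Type u) [Fintype V] (r : ℕ), 3 ≤ r →
      ∀ w : V → V → ℕ, IsColoured w → FamFree w (2 * r) →
      (∀ x : V, (2 - 12 / (6 * (r : ℝ) - 5)) * (Fintype.card V : ℝ)
          < ∑ y : V, (w x y : ℝ)) →
      ¬ HasSub w (BK (r + 1))) := by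
  refine ⟨fun V _ r hr w hw hF hdeg => not_hasSub_BK (by omega) hw hF fun x => ?_,
    fun V _ r hr w hw hF hdeg => not_hasSub_BK (by omega) hw hF hdeg⟩
  refine lt_of_le_of_lt (mul_le_mul_of_nonneg_right ?_ (Nat.cast_nonneg _)) (hdeg x)
  have hr' : (3 : ℝ) ≤ r := by exact_mod_cast hr
  have h6 : (0 : ℝ) < 6 * r - 5 := by linarith
  have h7 : (0 : ℝ) < 7 * r - 5 := by linarith
  rw [sub_le_iff_le_add, div_add_div _ _ h7.ne' h6.ne', le_div_iff₀ (mul_pos h7 h6)]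
  nlinarith
end

section
/- Let r ≥ 3 be an integer and let G be an extremal 𝓕_{2r}-free coloured graph on n vertices with δ(G) > ((14r−24)/(7r−5))·n. Then every edge of G of weight 1 is secure. -/
/-- An `𝓕_{2r}`-free coloured graph `(V, w)` is extremal if every `𝓕_{2r}`-free coloured
graph on `V` whose weight function pointwise dominates `w` coincides with `w`. -/
def Extremal {V : Type*} (w : V → V → ℕ) (r : ℕ) : Prop :=
  FamFree w (2 * r) ∧
    ∀ w' : V → V → ℕ, IsColoured w' → (∀ x y, w x y ≤ w' x y) → FamFree w' (2 * r) → w' = w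

/-- A pair of distinct vertices `x, y` is secure if it lies in the common red
neighbourhood of some red clique on `r - 2` vertices. -/
def Secure {V : Type*} (w : V → V → ℕ) (r : ℕ) (x y : V) : Prop :=
  ∃ A : Finset V, A.card = r - 2 ∧ x ∉ A ∧ y ∉ A ∧
    (∀ a ∈ A, ∀ a' ∈ A, a ≠ a' → w a a' = 2) ∧ (∀ a ∈ A, w a x = 2 ∧ w a y = 2)

/-- `A` is a red clique in the common red neighbourhood of `x` and `y`, and no two vertices of
`A ∪ B ∪ {x, y}` other than possibly `x` and `y` are joined by an edge of weight `0`. -/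
structure Config {V : Type*} (w : V → V → ℕ) (x y : V) (A B : Finset V) : Prop where
  red : ∀ p ∈ A, ∀ q ∈ A, p ≠ q → w p q = 2
  red_left : ∀ p ∈ A, w p x = 2
  red_right : ∀ p ∈ A, w p y = 2
  cross : ∀ p ∈ A, ∀ q ∈ B, 1 ≤ w p q
  blue : ∀ p ∈ B, ∀ q ∈ B, p ≠ q → 1 ≤ w p q
  blue_left : ∀ p ∈ B, 1 ≤ w p x
  blue_right : ∀ p ∈ B, 1 ≤ w p y

/-- There is no red clique `R` completely joined to a blue clique `C` with
`2 * |R| + |C| = 2 * r`. -/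
def NoClique {V : Type*} (w : V → V → ℕ) (r : ℕ) : Prop :=
  ∀ R C : Finset V, R.Nonempty → (∀ p ∈ R, ∀ q ∈ R, p ≠ q → w p q = 2) →
    (∀ p ∈ R, ∀ q ∈ C, 1 ≤ w p q) → (∀ p ∈ C, ∀ q ∈ C, p ≠ q → 1 ≤ w p q) →
    2 * R.card + C.card ≠ 2 * r

theorem Config.symm {V : Type*} {w : V → V → ℕ} {x y : V} {A B : Finset V}
    (h : Config w x y A B) : Config w y x A B :=
  ⟨h.red, h.red_right, h.red_left, h.cross, h.blue, h.blue_right, h.blue_left⟩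

theorem Config.mono {V : Type*} {w : V → V → ℕ} {x y : V} {A B B' : Finset V}
    (h : Config w x y A B) (hB : B' ⊆ B) : Config w x y A B' :=
  ⟨h.red, h.red_left, h.red_right, fun p hp q hq => h.cross p hp q (hB hq),
    fun p hp q hq => h.blue p (hB hp) q (hB hq), fun p hp => h.blue_left p (hB hp),
    fun p hp => h.blue_right p (hB hp)⟩

theorem FamFree.noClique {V : Type*} {w : V → V → ℕ} {r : ℕ} (hG : IsColoured w)
    (hF : FamFree w (2 * r)) : NoClique w r := by
  classical
  intro R C hR hRR hRC hCC hcard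
  obtain ⟨hs, -, h0⟩ := hG
  have hdisj : Disjoint R C := by
    rw [Finset.disjoint_left]
    intro a ha ha'
    have := hRC a ha a ha'
    rw [h0] at this
    omega
  have hpos := hR.card_pos
  refine hF R.card hpos (by omega) ?_
  have e1 : 2 * r - R.card = R.card + C.card := by omega
  let eR := R.equivFin.symm
  let eC := C.equivFin.symm
  have hmem : ∀ t : Fin (2 * r - R.card), ¬ t.val < R.card → t.val - R.card < C.card := by
    intro t ht
    have := t.isLt
    omega
  refine ⟨fun t => if h : t.val < R.card then (eR ⟨t.val, h⟩ : V)
    else (eC ⟨t.val - R.card, hmem t h⟩ : V), ?_, ?_⟩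
  · intro s t hst
    have hd : ∀ (a : R) (b : C), (a : V) ≠ b := fun a b hab =>
      Finset.disjoint_left.1 hdisj a.2 (hab ▸ b.2)
    by_cases h1 : s.val < R.card <;> by_cases h2 : t.val < R.card
    · simp only [h1, h2, dif_pos] at hst
      have := eR.injective (Subtype.ext hst)
      simp only [Fin.mk.injEq] at this
      exact Fin.ext this
    · simp only [h1, h2, dif_pos, dif_neg, not_false_eq_true] at hst
      exact absurd hst (hd _ _)
    · simp only [h1, h2, dif_pos, dif_neg, not_false_eq_true] at hst
      exact absurd hst.symm (hd _ _)
    · simp only [h1, h2, dif_neg, not_false_eq_true] at hst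
      have := eC.injective (Subtype.ext hst)
      simp only [Fin.mk.injEq] at this
      exact Fin.ext (by omega)
  · intro s t
    unfold Gt
    by_cases hst : s = t
    · simp [hst]
    have hst' : s.val ≠ t.val := fun h => hst (Fin.ext h)
    by_cases h1 : s.val < R.card <;> by_cases h2 : t.val < R.card
    · simp only [hst, h1, h2, dif_pos, and_self, if_true, if_false]
      refine (hRR _ (eR _).2 _ (eR _).2 ?_).ge
      intro h
      have := eR.injective (Subtype.ext h)
      simp only [Fin.mk.injEq] at this
      exact hst' this
    · simp only [hst, h1, h2, dif_pos, dif_neg, not_false_eq_true, and_false, if_false]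
      exact hRC _ (eR _).2 _ (eC _).2
    · simp only [hst, h1, h2, dif_pos, dif_neg, not_false_eq_true, false_and, if_false]
      rw [hs]
      exact hRC _ (eR _).2 _ (eC _).2
    · simp only [hst, h1, h2, dif_neg, not_false_eq_true, and_self, if_false]
      refine hCC _ (eC _).2 _ (eC _).2 ?_
      intro h
      have := eC.injective (Subtype.ext h)
      simp only [Fin.mk.injEq] at this
      omega

/-- Raising the weight of a blue edge `xy` of an extremal graph creates a forbidden subgraph, in
which `x` and `y` belong to the red clique. -/
theorem Extremal.exists_config {V : Type*} {w : V → V → ℕ} {r : ℕ} (hG : IsColoured w)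
    (hext : Extremal w r) {x y : V} (hxy : x ≠ y) (h1 : w x y = 1) :
    ∃ A B : Finset V, Config w x y A B ∧ 2 * A.card + B.card = 2 * r - 4 := by
  classical
  obtain ⟨hs, h2, h0⟩ := hG
  obtain ⟨hF, hmax⟩ := hext
  let w' : V → V → ℕ := fun a b => if (a = x ∧ b = y) ∨ (a = y ∧ b = x) then 2 else w a b
  have hle : ∀ a b, w a b ≤ w' a b := by
    intro a b
    simp only [w']
    split_ifs
    · exact h2 a b
    · exact le_rfl
  have hcol : IsColoured w' := by
    refine ⟨?_, ?_, ?_⟩ <;> intros <;> simp only [w'] <;> grind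
  have hne : w' ≠ w := by
    intro h
    have := congrFun (congrFun h x) y
    simp [w', h1] at this
  have hnF : ¬ FamFree w' (2 * r) := fun h => hne (hmax w' hcol hle h)
  unfold FamFree at hnF
  push Not at hnF
  obtain ⟨i, hi1, hi2, φ, hφ, hsub⟩ := hnF
  have hbad : ∃ s t, w (φ s) (φ t) < Gt (2 * r) i s t := by
    by_contra! hcon
    exact hF i hi1 hi2 ⟨φ, hφ, hcon⟩
  have hst : ∃ s t, s.val < i ∧ t.val < i ∧ φ s = x ∧ φ t = y := by
    obtain ⟨s, t, hst⟩ := hbad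
    have := hsub s t
    have hyx := hs x y
    simp only [Gt, w'] at this hst
    grind
  obtain ⟨s, t, hsi, hti, rfl, rfl⟩ := hst
  have hst : s ≠ t := fun h => hxy (by rw [h])
  have hw : ∀ a b, (a ≠ s ∨ b ≠ t) → (a ≠ t ∨ b ≠ s) → Gt (2 * r) i a b ≤ w (φ a) (φ b) := by
    intro a b hab hba
    have := hsub a b
    have hn : ¬ ((φ a = φ s ∧ φ b = φ t) ∨ (φ a = φ t ∧ φ b = φ s)) := by
      simp only [hφ.eq_iff]
      tauto
    simpa only [w', if_neg hn] using this
  let I : Finset (Fin (2 * r - i)) := Finset.univ.filter (fun a => a.val < i)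
  let J : Finset (Fin (2 * r - i)) := Finset.univ.filter (fun a => ¬ a.val < i)
  have hI : I.card = i := by
    have : I.map Fin.valEmbedding = Finset.range i := by
      ext k
      simp only [I, Finset.mem_map, Finset.mem_filter, Finset.mem_univ, true_and,
        Fin.valEmbedding_apply, Finset.mem_range]
      constructor
      · rintro ⟨a, ha, rfl⟩
        exact ha
      · intro hk
        exact ⟨⟨k, by omega⟩, hk, rfl⟩
    rw [← Finset.card_map Fin.valEmbedding, this, Finset.card_range]
  have hIJ : I.card + J.card = 2 * r - i := by
    have := Finset.card_filter_add_card_filter_not (s := (Finset.univ : Finset (Fin (2 * r - i))))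
      (fun a => a.val < i)
    simpa [I, J] using this
  have hle2 : ∀ a b, a.val < i → b.val < i → a ≠ b → (a ≠ s ∨ b ≠ t) → (a ≠ t ∨ b ≠ s) →
      w (φ a) (φ b) = 2 := by
    intro a b ha hb hab h h'
    have := hw a b h h'
    simp only [Gt, if_neg hab, ha, hb, and_self, if_true] at this
    exact le_antisymm (h2 _ _) this
  have hle1 : ∀ a b, a ≠ b → (a ≠ s ∨ b ≠ t) → (a ≠ t ∨ b ≠ s) → 1 ≤ w (φ a) (φ b) := by
    intro a b hab h h'
    have := hw a b h h'
    simp only [Gt, if_neg hab] at this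
    split_ifs at this <;> omega
  refine ⟨((I.erase s).erase t).image φ, J.image φ, ⟨?_, ?_, ?_, ?_, ?_, ?_, ?_⟩, ?_⟩
  · simp only [Finset.forall_mem_image]
    intro a ha b hb hab
    simp only [Finset.mem_erase, I, Finset.mem_filter, Finset.mem_univ, true_and] at ha hb
    exact hle2 a b ha.2.2 hb.2.2 (fun h => hab (by rw [h])) (by tauto) (by tauto)
  · simp only [Finset.forall_mem_image]
    intro a ha
    simp only [Finset.mem_erase, I, Finset.mem_filter, Finset.mem_univ, true_and] at ha
    exact hle2 a s ha.2.2 hsi (by tauto) (by tauto) (by tauto)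
  · simp only [Finset.forall_mem_image]
    intro a ha
    simp only [Finset.mem_erase, I, Finset.mem_filter, Finset.mem_univ, true_and] at ha
    exact hle2 a t ha.2.2 hti (by tauto) (by tauto) (by tauto)
  · simp only [Finset.forall_mem_image]
    intro a ha b hb
    simp only [Finset.mem_erase, I, J, Finset.mem_filter, Finset.mem_univ, true_and] at ha hb
    exact hle1 a b (by rintro rfl; tauto) (by tauto) (by tauto)
  · simp only [Finset.forall_mem_image]
    intro a ha b hb hab
    simp only [J, Finset.mem_filter, Finset.mem_univ, true_and] at ha hb
    exact hle1 a b (fun h => hab (by rw [h])) (by grind) (by grind)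
  · simp only [Finset.forall_mem_image]
    intro a ha
    simp only [J, Finset.mem_filter, Finset.mem_univ, true_and] at ha
    exact hle1 a s (by grind) (by grind) (by grind)
  · simp only [Finset.forall_mem_image]
    intro a ha
    simp only [J, Finset.mem_filter, Finset.mem_univ, true_and] at ha
    exact hle1 a t (by grind) (by grind) (by grind)
  · rw [Finset.card_image_of_injective _ hφ, Finset.card_image_of_injective _ hφ,
      Finset.card_erase_of_mem, Finset.card_erase_of_mem]
    · have : 2 ≤ I.card := by
        refine (Finset.card_pair hst).ge.trans (Finset.card_le_card ?_)
        intro a ha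
        simp only [Finset.mem_insert, Finset.mem_singleton] at ha
        rcases ha with rfl | rfl <;> simp [I, *]
      omega
    · simp [I, hsi]
    · simp [I, hti, hst.symm]

/-- Averaging: if `m` has total weight at most `6 * (7 * r - 5)`, then some vertex has weighted
deficiency less than `84`. -/
theorem exists_small_deficiency {V : Type*} [Fintype V] {r : ℕ} (hr : 3 ≤ r)
    {w : V → V → ℕ} (hG : IsColoured w)
    (hdeg : ∀ x : V,
      (14 * (r : ℝ) - 24) / (7 * (r : ℝ) - 5) * (Fintype.card V : ℝ) < ∑ y : V, (w x y : ℝ))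
    (S : Finset V) (m : V → ℕ) (hS : S.Nonempty) (hm : ∀ u ∈ S, 0 < m u)
    (hsum : ∑ u ∈ S, m u + 30 ≤ 42 * r) :
    ∃ v, ∑ u ∈ S, m u * (2 - w u v) < 84 := by
  obtain ⟨-, h2, -⟩ := hG
  have hr' : (3 : ℝ) ≤ r := by exact_mod_cast hr
  have hpos : (0 : ℝ) < 7 * r - 5 := by linarith
  by_contra! hcon
  have hdef : ∀ u, (7 * (r : ℝ) - 5) * ∑ v, ((2 - w u v : ℕ) : ℝ) < 14 * Fintype.card V := by
    intro u
    have h := hdeg u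
    rw [div_mul_eq_mul_div, div_lt_iff₀ hpos] at h
    have h' : ∑ v, ((2 - w u v : ℕ) : ℝ) = 2 * Fintype.card V - ∑ v, (w u v : ℝ) := by
      rw [eq_sub_iff_add_eq, ← Finset.sum_add_distrib]
      have : ∀ v ∈ (Finset.univ : Finset V), ((2 - w u v : ℕ) : ℝ) + w u v = 2 := by
        intro v _
        rw [Nat.cast_sub (h2 u v)]
        simp
      rw [Finset.sum_congr rfl this]
      simp [mul_comm]
    rw [h']
    linarith
  have hlow : (84 : ℝ) * Fintype.card V ≤ ∑ v, ∑ u ∈ S, (m u : ℝ) * ((2 - w u v : ℕ) : ℝ) := by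
    have : ∀ v ∈ (Finset.univ : Finset V),
        (84 : ℝ) ≤ ∑ u ∈ S, (m u : ℝ) * ((2 - w u v : ℕ) : ℝ) := by
      intro v _
      exact_mod_cast hcon v
    have := Finset.sum_le_sum this
    simpa [mul_comm] using this
  rw [Finset.sum_comm] at hlow
  have hup : (7 * (r : ℝ) - 5) * ∑ u ∈ S, ∑ v, (m u : ℝ) * ((2 - w u v : ℕ) : ℝ)
      < ∑ u ∈ S, (m u : ℝ) * (14 * Fintype.card V) := by
    rw [Finset.mul_sum]
    refine Finset.sum_lt_sum_of_nonempty hS fun u hu => ?_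
    rw [← Finset.mul_sum, mul_left_comm]
    exact mul_lt_mul_of_pos_left (hdef u) (by exact_mod_cast hm u hu)
  rw [← Finset.sum_mul] at hup
  have hsum' : ∑ u ∈ S, (m u : ℝ) + 30 ≤ 42 * r := by exact_mod_cast hsum
  have h3 := mul_le_mul_of_nonneg_left hlow hpos.le
  have h4 := mul_le_mul_of_nonneg_right hsum'
    (by positivity : (0 : ℝ) ≤ 14 * Fintype.card V)
  nlinarith

/-- Any one, two or three terms of the weighted deficiency in `exists_small_deficiency`. -/
theorem exists_small_deficiencies {V : Type*} [Fintype V] {r : ℕ} (hr : 3 ≤ r)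
    {w : V → V → ℕ} (hG : IsColoured w)
    (hdeg : ∀ x : V,
      (14 * (r : ℝ) - 24) / (7 * (r : ℝ) - 5) * (Fintype.card V : ℝ) < ∑ y : V, (w x y : ℝ))
    (S : Finset V) (m : V → ℕ) (hS : S.Nonempty) (hm : ∀ u ∈ S, 0 < m u)
    (hsum : ∑ u ∈ S, m u + 30 ≤ 42 * r) :
    ∃ v, (∀ u ∈ S, m u * (2 - w u v) < 84) ∧
      (∀ u ∈ S, ∀ u' ∈ S, u ≠ u' → m u * (2 - w u v) + m u' * (2 - w u' v) < 84) ∧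
      (∀ u ∈ S, ∀ u' ∈ S, ∀ u'' ∈ S, u ≠ u' → u ≠ u'' → u' ≠ u'' →
        m u * (2 - w u v) + m u' * (2 - w u' v) + m u'' * (2 - w u'' v) < 84) := by
  classical
  obtain ⟨v, hv⟩ := exists_small_deficiency hr hG hdeg S m hS hm hsum
  have hT : ∀ T ⊆ S, ∑ u ∈ T, m u * (2 - w u v) < 84 := fun T hT =>
    (Finset.sum_le_sum_of_subset hT).trans_lt hv
  refine ⟨v, ?_, ?_, ?_⟩
  · intro u hu
    simpa using hT {u} (by simpa using hu)
  · intro u hu u' hu' h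
    have := hT {u, u'} (by grind)
    rwa [Finset.sum_pair h] at this
  · intro u hu u' hu' u'' hu'' h h' h''
    have := hT {u, u', u''} (by grind)
    rw [Finset.sum_insert (by grind), Finset.sum_pair h''] at this
    omega

/-- Some configuration of the same size `2 * r - 4` has a red part larger by one, up to deleting
superfluous vertices of its blue part. -/
def Improvable {V : Type*} (w : V → V → ℕ) (r : ℕ) (x y : V) (k : ℕ) : Prop :=
  ∃ A B : Finset V, Config w x y A B ∧ A.card = k + 1 ∧ 2 * r ≤ 2 * A.card + B.card + 4

theorem Improvable.symm {V : Type*} {w : V → V → ℕ} {r : ℕ} {x y : V} {k : ℕ}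
    (h : Improvable w r x y k) : Improvable w r y x k :=
  let ⟨A, B, hAB, h⟩ := h
  ⟨A, B, hAB.symm, h⟩

section

variable {V : Type*} [DecidableEq V] {w : V → V → ℕ} {r : ℕ} {x y : V} {A B : Finset V}

theorem Config.exists_eq_zero (hG : IsColoured w) (hN : NoClique w r) (hAB : Config w x y A B)
    (hxy : w x y = 1) (hc : 2 * A.card + B.card + 4 = 2 * r) (v : V) :
    ∃ u ∈ insert x (insert y (A ∪ B)), w u v = 0 := by
  obtain ⟨hs, h2, h0⟩ := hG
  obtain ⟨a1, a2, a3, a4, a5, a6, a7⟩ := hAB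
  by_contra! hcon
  refine hN (insert x A) (insert y (insert v B)) (by simp) ?_ ?_ ?_ ?_
  · grind
  · grind
  · grind
  · rw [Finset.card_insert_of_notMem (by grind), Finset.card_insert_of_notMem (by grind),
      Finset.card_insert_of_notMem (by grind)]
    omega

/-- A vertex cannot replace `x` and be joined in red to `y`. -/
theorem Config.not_replace (hG : IsColoured w) (hN : NoClique w r) (hAB : Config w x y A B)
    (hc : 2 * A.card + B.card + 4 = 2 * r) {v : V} (hA : ∀ u ∈ A, w u v = 2)
    (hy : w y v = 2) (hB : ∀ u ∈ B, w u v ≠ 0) : False := by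
  obtain ⟨hs, h2, h0⟩ := hG
  obtain ⟨a1, a2, a3, a4, a5, a6, a7⟩ := hAB
  refine hN (insert v (insert y A)) B (by simp) ?_ ?_ ?_ ?_
  · grind
  · grind
  · grind
  · rw [Finset.card_insert_of_notMem (by grind), Finset.card_insert_of_notMem (by grind)]
    omega

/-- A vertex joined in red to `A` and `y` cannot replace an element of `B`. -/
theorem Config.not_swap_of_red_right (hG : IsColoured w) (hN : NoClique w r)
    (himp : ¬ Improvable w r x y A.card)
    (hAB : Config w x y A B) (hxy : w x y = 1)
    (hc : 2 * A.card + B.card + 4 = 2 * r) {v z : V} (hz : z ∈ B) (hA : ∀ u ∈ A, w u v = 2)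
    (hx : w x v ≠ 0) (hy : w y v = 2) (hB : ∀ u ∈ B, u ≠ z → w u v ≠ 0) : False := by
  obtain ⟨hs, h2, h0⟩ := hG
  obtain ⟨a1, a2, a3, a4, a5, a6, a7⟩ := hAB
  have hz' := Finset.card_erase_add_one hz
  by_cases hx2 : w x v = 2
  · refine himp ⟨insert v A, B.erase z, ⟨?_, ?_, ?_, ?_, ?_, ?_, ?_⟩, ?_⟩
    iterate 7 grind
    rw [Finset.card_insert_of_notMem (by grind)]
    omega
  · refine hN (insert v (insert y A)) (insert x (B.erase z)) (by simp) ?_ ?_ ?_ ?_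
    · grind
    · grind
    · grind
    · rw [Finset.card_insert_of_notMem (by grind), Finset.card_insert_of_notMem (by grind),
        Finset.card_insert_of_notMem (by grind)]
      omega

/-- A vertex joined in red to `A`, `x` and `y` has at least three non-neighbours in `B`. -/
theorem Config.not_red_of_two_zeros (hG : IsColoured w)
    (himp : ¬ Improvable w r x y A.card) (hAB : Config w x y A B)
    (hc : 2 * A.card + B.card + 4 = 2 * r) {v z z' : V} (hz : z ∈ B)
    (hA : ∀ u ∈ A, w u v = 2)
    (hx : w x v = 2) (hy : w y v = 2) (hB : ∀ u ∈ B, u ≠ z → u ≠ z' → w u v ≠ 0) : False := by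
  obtain ⟨hs, h2, h0⟩ := hG
  obtain ⟨a1, a2, a3, a4, a5, a6, a7⟩ := hAB
  have e := Finset.card_erase_add_one hz
  have e' : (B.erase z).card ≤ ((B.erase z).erase z').card + 1 := by
    have := Finset.pred_card_le_card_erase (s := B.erase z) (a := z')
    omega
  refine himp ⟨insert v A, (B.erase z).erase z', ⟨?_, ?_, ?_, ?_, ?_, ?_, ?_⟩, ?_⟩
  iterate 7 grind
  rw [Finset.card_insert_of_notMem (by grind)]
  omega

/-- Two vertices joined in red to each other and to `x`, `y`, `A` except for `p` cannot both
be added to `A` in exchange for `p`, even at the cost of two elements of `B`. -/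
theorem Config.not_exchange (hG : IsColoured w)
    (himp : ¬ Improvable w r x y A.card) (hAB : Config w x y A B)
    (hc : 2 * A.card + B.card + 4 = 2 * r) {v z z' p : V} (hp : p ∈ A) (hz : z ∈ B)
    (hz' : z' ∈ B) (hzz' : z ≠ z') (hzA : ∀ u ∈ A, u ≠ p → w u z = 2)
    (hzx : w x z = 2) (hzy : w y z = 2) (hvz : w z v = 2) (hA : ∀ u ∈ A, u ≠ p → w u v = 2)
    (hx : w x v = 2) (hy : w y v = 2) (hB : ∀ u ∈ B, u ≠ z' → w u v ≠ 0) (hpv : w p v ≠ 0) :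
    False := by
  obtain ⟨hs, h2, h0⟩ := hG
  obtain ⟨a1, a2, a3, a4, a5, a6, a7⟩ := hAB
  have e := Finset.card_erase_add_one hz
  have e' := Finset.card_erase_add_one (s := B.erase z) (a := z') (by grind)
  have ep := Finset.card_erase_add_one hp
  refine himp ⟨insert v (insert z (A.erase p)), insert p ((B.erase z).erase z'),
    ⟨?_, ?_, ?_, ?_, ?_, ?_, ?_⟩, ?_⟩
  iterate 7 grind
  rw [Finset.card_insert_of_notMem (by grind), Finset.card_insert_of_notMem (by grind),
    Finset.card_insert_of_notMem (by grind)]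
  omega

/-- A variant of `Config.not_exchange` for a vertex `v` not adjacent to `p`. -/
theorem Config.not_exchange_zero (hG : IsColoured w)
    (himp : ¬ Improvable w r x y A.card) (hAB : Config w x y A B)
    (hc : 2 * A.card + B.card + 4 = 2 * r) {v z p : V} (hp : p ∈ A) (hz : z ∈ B)
    (hzA : ∀ u ∈ A, u ≠ p → w u z = 2)
    (hzx : w x z = 2) (hzy : w y z = 2) (hvz : w z v = 2) (hA : ∀ u ∈ A, u ≠ p → w u v = 2)
    (hx : w x v = 2) (hy : w y v = 2) (hB : ∀ u ∈ B, w u v ≠ 0) :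
    False := by
  obtain ⟨hs, h2, h0⟩ := hG
  obtain ⟨a1, a2, a3, a4, a5, a6, a7⟩ := hAB
  have e := Finset.card_erase_add_one hz
  have ep := Finset.card_erase_add_one hp
  refine himp ⟨insert v (insert z (A.erase p)), B.erase z, ⟨?_, ?_, ?_, ?_, ?_, ?_, ?_⟩, ?_⟩
  iterate 7 grind
  rw [Finset.card_insert_of_notMem (by grind), Finset.card_insert_of_notMem (by grind)]
  omega

end

theorem sum_sum_insert {V : Type*} [DecidableEq V] {w : V → V → ℕ} (hG : IsColoured w)
    {T : Finset V} {v : V} (hv : v ∉ T) :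
    ∑ p ∈ insert v T, ∑ q ∈ insert v T, w p q
      = ∑ p ∈ T, ∑ q ∈ T, w p q + 2 * ∑ p ∈ T, w p v := by
  obtain ⟨hs, -, h0⟩ := hG
  have h1 : ∑ p ∈ T, w v p = ∑ p ∈ T, w p v := Finset.sum_congr rfl fun p _ => hs v p
  simp only [Finset.sum_insert hv, Finset.sum_add_distrib, h0, h1]
  ring

/-- If replacing `z` by a vertex `v` with total deficiency one does not increase the total weight,
then `z` is joined in red to all but at most one of the other vertices. -/
theorem red_of_replace {V : Type*} [DecidableEq V] {w : V → V → ℕ} (hG : IsColoured w)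
    {T : Finset V} {v z p : V} (hv : v ∉ T) (hz : z ∉ T)
    (hle : ∑ p ∈ insert v T, ∑ q ∈ insert v T, w p q
      ≤ ∑ p ∈ insert z T, ∑ q ∈ insert z T, w p q)
    (hp : w p v = 1) (hred : ∀ u ∈ T, u ≠ p → w u v = 2) {u u' : V} (hu : u ∈ T) (hu' : u' ∈ T)
    (huu' : u ≠ u') (h : w u z ≠ 2) : w u' z = 2 := by
  rw [sum_sum_insert hG hv, sum_sum_insert hG hz] at hle
  obtain ⟨-, h2, -⟩ := hG
  have hcompl : ∀ a, ∑ u ∈ T, w u a + ∑ u ∈ T, (2 - w u a) = ∑ u ∈ T, 2 := by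
    intro a
    rw [← Finset.sum_add_distrib]
    refine Finset.sum_congr rfl fun u _ => ?_
    have := h2 u a
    omega
  have hv1 : ∑ u ∈ T, (2 - w u v) ≤ 1 := by
    calc ∑ u ∈ T, (2 - w u v) ≤ ∑ u ∈ T, if u = p then 1 else 0 := by
          refine Finset.sum_le_sum fun u hu => ?_
          split_ifs with hup
          · rw [hup, hp]
          · rw [hred u hu hup]
      _ ≤ 1 := by
          rw [Finset.sum_ite_eq']
          split_ifs <;> omega
  have hz1 : ∑ t ∈ {u, u'}, (2 - w t z) ≤ ∑ t ∈ T, (2 - w t z) :=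
    Finset.sum_le_sum_of_subset (by grind)
  rw [Finset.sum_pair huu'] at hz1
  have := hcompl v
  have := hcompl z
  have := h2 u z
  have := h2 u' z
  omega

theorem insert_replace {V : Type*} [DecidableEq V] {A B : Finset V} {x y z v p : V} (hp : p ∈ A)
    (hzA : z ∉ A) (hxz : x ≠ z) (hyz : y ≠ z) :
    insert x (insert y (insert v (A.erase p) ∪ insert p (B.erase z)))
      = insert v ((insert x (insert y (A ∪ B))).erase z) := by
  ext u
  simp only [Finset.mem_insert, Finset.mem_union, Finset.mem_erase]
  grind

section

variable {V : Type*} [DecidableEq V] {w : V → V → ℕ} {r : ℕ} {x y : V} {A B : Finset V}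

theorem Config.exists_twin (hG : IsColoured w) (hN : NoClique w r)
    (himp : ¬ Improvable w r x y A.card) (hAB : Config w x y A B) (hxy : w x y = 1)
    (hc : 2 * A.card + B.card + 4 = 2 * r)
    (hmax : ∀ A' B' : Finset V, Config w x y A' B' → A'.card = A.card → B'.card = B.card →
      ∑ p ∈ insert x (insert y (A' ∪ B')), ∑ q ∈ insert x (insert y (A' ∪ B')), w p q
        ≤ ∑ p ∈ insert x (insert y (A ∪ B)), ∑ q ∈ insert x (insert y (A ∪ B)), w p q)
    {v z p : V} (hz : z ∈ B) (hp : p ∈ A) (hzv : w z v = 0) (hpv : w p v = 1)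
    (hred : ∀ u ∈ insert x (insert y (A ∪ B)), u ≠ z → u ≠ p → w u v = 2) :
    ∃ q ∈ A, w q z = 1 ∧ ∀ u ∈ insert x (insert y (A ∪ B)), u ≠ z → u ≠ q → w u z = 2 := by
  have hAB' := hAB
  have hG' := hG
  obtain ⟨hs, h2, h0⟩ := hG'
  obtain ⟨a1, a2, a3, a4, a5, a6, a7⟩ := hAB'
  set S := insert x (insert y (A ∪ B)) with hS
  have hzS : z ∈ S := by grind
  have hAS : A ⊆ S := by grind
  have hBS : B ⊆ S := by grind
  have hxS : x ∈ S := by grind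
  have hyS : y ∈ S := by grind
  have hvT : v ∉ S.erase z := by
    intro hv
    have := h0 v
    grind
  have hzA : z ∉ A := by grind
  have hxz : x ≠ z := by grind
  have hyz : y ≠ z := by grind
  have hxy' : x ≠ y := by grind
  have hnew := insert_replace (B := B) (v := v) hp hzA hxz hyz
  rw [← hS] at hnew
  have hconf : Config w x y (insert v (A.erase p)) (insert p (B.erase z)) := by
    have hredA : ∀ a ∈ A, a ≠ p → w a v = 2 := fun a ha => hred a (hAS ha) (by grind)
    have hredB : ∀ b ∈ B, b ≠ z → w b v = 2 := fun b hb hbz =>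
      hred b (hBS hb) hbz (by grind)
    have hredx : w x v = 2 := hred x hxS hxz (by grind)
    have hredy : w y v = 2 := hred y hyS hyz (by grind)
    clear hred hmax hS hAS hBS hnew
    have hpB : p ∉ B := by grind
    constructor <;> grind
  have hle := hmax _ _ hconf
    (by rw [Finset.card_insert_of_notMem (by grind), Finset.card_erase_add_one hp])
    (by rw [Finset.card_insert_of_notMem (by grind), Finset.card_erase_add_one hz])
  rw [hnew] at hle
  have hle' : ∑ p ∈ insert v (S.erase z), ∑ q ∈ insert v (S.erase z), w p q
      ≤ ∑ p ∈ insert z (S.erase z), ∑ q ∈ insert z (S.erase z), w p q := by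
    rwa [Finset.insert_erase hzS]
  have key : ∀ u ∈ S, ∀ u' ∈ S, u ≠ z → u' ≠ z → u ≠ u' → w u z ≠ 2 → w u' z = 2 := by
    intro u hu u' hu' huz hu'z huu' h
    exact red_of_replace hG hvT (by simp) hle' hpv (by grind)
      (Finset.mem_erase.2 ⟨huz, hu⟩) (Finset.mem_erase.2 ⟨hu'z, hu'⟩) huu' h
  by_cases hq : ∃ q ∈ A, w q z ≠ 2
  · obtain ⟨q, hqA, hq⟩ := hq
    refine ⟨q, hqA, by grind, ?_⟩
    intro u hu huz huq
    exact key q (hAS hqA) u hu (by grind) huz (Ne.symm huq) hq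
  · push Not at hq
    exfalso
    by_cases hy : w y z = 2
    · exact hAB.not_swap_of_red_right hG hN himp hxy hc hz hq (by grind) hy (by grind)
    · exact hAB.symm.not_swap_of_red_right hG hN (fun h => himp h.symm) (by grind) hc hz hq
        (by grind) (key y hyS x hxS hyz hxz hxy'.symm hy) (by grind)

/-- In an unimprovable configuration, no element of `B` is joined in red to all but one of the
other vertices, the exception being in `A`. -/
theorem Config.not_twin [Fintype V] (hr : 3 ≤ r) (hG : IsColoured w)
    (hdeg : ∀ x : V,
      (14 * (r : ℝ) - 24) / (7 * (r : ℝ) - 5) * (Fintype.card V : ℝ) < ∑ y : V, (w x y : ℝ))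
    (hN : NoClique w r) (himp : ¬ Improvable w r x y A.card) (hAB : Config w x y A B)
    (hxy : w x y = 1) (hc : 2 * A.card + B.card + 4 = 2 * r)
    {z p : V} (hz : z ∈ B) (hp : p ∈ A) (hpz : w p z = 1)
    (hzred : ∀ u ∈ insert x (insert y (A ∪ B)), u ≠ z → u ≠ p → w u z = 2) : False := by
  have himp' : ¬ Improvable w r y x A.card := fun h => himp h.symm
  have hG' := hG
  obtain ⟨hs, h2, h0⟩ := hG'
  have hyx : w y x = 1 := by rw [hs, hxy]
  have hAB' := hAB
  obtain ⟨a1, a2, a3, a4, a5, a6, a7⟩ := hAB'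
  have hxA : x ∉ A := by grind
  have hyA : y ∉ A := by grind
  have hxB : x ∉ B := by grind
  have hyB : y ∉ B := by grind
  have hxy' : x ≠ y := by grind
  have hdisj : ∀ u ∈ A, u ∉ B := by grind
  set S := insert x (insert y (A ∪ B)) with hS
  have hAS : ∀ u ∈ A, u ∈ S := by grind
  have hBS : ∀ u ∈ B, u ∈ S := by grind
  have hxS : x ∈ S := by grind
  have hyS : y ∈ S := by grind
  have hzero : ∀ v, ∃ u ∈ S, w u v = 0 := fun v => hAB.exists_eq_zero hG hN hxy hc v
  have hSc : ∀ u ∈ S, u = x ∨ u = y ∨ u ∈ A ∨ u ∈ B := by grind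
  have hsumS : ∀ m : V → ℕ, ∑ u ∈ S, m u = m x + m y + ∑ u ∈ A, m u + ∑ u ∈ B, m u := by
    intro m
    rw [hS, Finset.sum_insert (by grind), Finset.sum_insert (by grind),
      Finset.sum_union (Finset.disjoint_left.2 hdisj)]
    ring
  have hval : ∀ a b, w a b = 0 ∨ w a b = 1 ∨ w a b = 2 := by
    intro a b
    have := h2 a b
    omega
  clear hS
  let m : V → ℕ := fun u =>
    if u = x ∨ u = y ∨ u = p ∨ u = z then 28 else if u ∈ A then 42 else 21
  have hmx : m x = 28 := by simp [m]
  have hmy : m y = 28 := by simp [m]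
  have hmp : m p = 28 := by simp [m]
  have hmz : m z = 28 := by simp [m]
  have hmA : ∀ u ∈ A, u ≠ p → m u = 42 := by grind
  have hmB : ∀ u ∈ B, u ≠ z → m u = 21 := by grind
  have hsum : ∑ u ∈ S, m u + 30 ≤ 42 * r := by
    rw [hsumS, ← Finset.add_sum_erase A m hp, ← Finset.add_sum_erase B m hz,
      Finset.sum_congr rfl (g := fun _ => 42) (s₁ := A.erase p)
        (fun u hu => hmA u (by grind) (by grind)),
      Finset.sum_congr rfl (g := fun _ => 21) (s₁ := B.erase z)
        (fun u hu => hmB u (by grind) (by grind))]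
    have := Finset.card_erase_add_one hp
    have := Finset.card_erase_add_one hz
    simp only [Finset.sum_const, smul_eq_mul]
    omega
  obtain ⟨v, d1, d2, d3⟩ := exists_small_deficiencies hr hG hdeg S m ⟨x, hxS⟩
    (fun u hu => by simp only [m]; split_ifs <;> omega) hsum
  have hm28 : ∀ u ∈ S, (u = x ∨ u = y ∨ u ∈ A ∨ u = z) → 28 ≤ m u := by grind
  have hm21 : ∀ u ∈ S, 21 ≤ m u := by grind
  clear_value m
  -- a non-neighbour of `v` is unique
  have huniq : ∀ u ∈ S, ∀ u' ∈ S, w u v = 0 → w u' v = 0 → u = u' := by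
    intro u hu u' hu' hw hw'
    by_contra hne
    have := d2 u hu u' hu' hne
    rw [hw, hw'] at this
    have := hm21 u hu
    have := hm21 u' hu'
    omega
  -- if the non-neighbour has weight 28 then all other vertices of weight 28 are red
  have h28 : ∀ u ∈ S, 28 ≤ m u → w u v = 0 → ∀ c ∈ S, c ≠ u → 28 ≤ m c → w c v = 2 := by
    intro u hu hm hw c hc hne hm'
    have := d2 u hu c hc (Ne.symm hne)
    rw [hw] at this
    rcases hval c v with h | h | h <;> rw [h] at this <;> omega
  have hmA' : ∀ a ∈ A, 28 ≤ m a := fun a ha => hm28 a (hAS a ha) (Or.inr (Or.inr (Or.inl ha)))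
  have hzS := hBS z hz
  have hpS := hAS p hp
  have hzA : ∀ a ∈ A, a ≠ z := fun a ha h => hdisj a ha (h ▸ hz)
  have hAx : ∀ a ∈ A, a ≠ x := fun a ha => ne_of_mem_of_not_mem ha hxA
  have hAy : ∀ a ∈ A, a ≠ y := fun a ha => ne_of_mem_of_not_mem ha hyA
  have hBx : ∀ b ∈ B, b ≠ x := fun b hb => ne_of_mem_of_not_mem hb hxB
  have hBy : ∀ b ∈ B, b ≠ y := fun b hb => ne_of_mem_of_not_mem hb hyB
  have hzredA : ∀ a ∈ A, a ≠ p → w a z = 2 := fun a ha => hzred a (hAS a ha) (hzA a ha)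
  have hzx : w x z = 2 := hzred x hxS (hBx z hz).symm (hAx p hp).symm
  have hzy : w y z = 2 := hzred y hyS (hBy z hz).symm (hAy p hp).symm
  obtain ⟨u, hu, hu0⟩ := hzero v
  have hne : ∀ c ∈ S, c ≠ u → w c v ≠ 0 := fun c hc hcu h0 => hcu (huniq c hc u hu h0 hu0)
  have hBne : ∀ b ∈ B, b ≠ u → w b v ≠ 0 := fun b hb => hne b (hBS b hb)
  rcases hSc u hu with hux | huy | huA | huB
  · subst hux
    have hr := h28 u hu hmx.ge hu0
    exact hAB.not_replace hG hN hc (fun a ha => hr a (hAS a ha) (hAx a ha) (hmA' a ha))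
      (hr y hyS hxy'.symm hmy.ge) (fun b hb => hBne b hb (hBx b hb))
  · subst huy
    have hr := h28 u hu hmy.ge hu0
    exact hAB.symm.not_replace hG hN hc (fun a ha => hr a (hAS a ha) (hAy a ha) (hmA' a ha))
      (hr x hxS hxy' hmx.ge) (fun b hb => hBne b hb (hBy b hb))
  · by_cases hup : u = p
    · subst hup
      have hr := h28 u hu hmp.ge hu0
      exact hAB.not_exchange_zero hG himp hc hp hz hzredA hzx hzy
        (hr z hzS (hzA u hp).symm hmz.ge) (fun a ha hau => hr a (hAS a ha) hau (hmA' a ha))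
        (hr x hxS (hAx u hp).symm hmx.ge) (hr y hyS (hAy u hp).symm hmy.ge)
        (fun b hb => hBne b hb fun h => hdisj u hp (h ▸ hb))
    · have := d1 u hu
      rw [hu0, hmA u huA hup] at this
      omega
  · have hxu : x ≠ u := (hBx u huB).symm
    have hyu : y ≠ u := (hBy u huB).symm
    have hAu : ∀ a ∈ A, a ≠ u := fun a ha h => hdisj a ha (h ▸ huB)
    by_cases huz : u = z
    · subst huz
      have hr := h28 u hu hmz.ge hu0
      exact hAB.not_swap_of_red_right hG hN himp hxy hc huB
        (fun a ha => hr a (hAS a ha) (hAu a ha) (hmA' a ha)) (hne x hxS hxu)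
        (hr y hyS hyu hmy.ge) hBne
    have hmu := hmB u huB huz
    have hpair : ∀ b ∈ S, ∀ c ∈ S, b ≠ c → b ≠ u → c ≠ u → 28 ≤ m b → 28 ≤ m c →
        w b v ≠ 2 → w c v = 2 := by
      intro b hb c hc hbc hbu hcu hmb hmc hwb
      have := d3 u hu b hb c hc (Ne.symm hbu) (Ne.symm hcu) hbc
      rw [hu0, hmu] at this
      rcases hval b v with h | h | h <;> rcases hval c v with h' | h' | h' <;>
        rw [h, h'] at this <;> omega
    by_cases hA2 : ∀ a ∈ A, w a v = 2
    · by_cases hy : w y v = 2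
      · exact hAB.not_swap_of_red_right hG hN himp hxy hc huB hA2 (hne x hxS hxu) hy hBne
      · exact hAB.symm.not_swap_of_red_right hG hN himp' hyx hc huB hA2 (hne y hyS hyu)
          (hpair y hyS x hxS hxy'.symm hyu hxu hmy.ge hmx.ge hy) hBne
    · push Not at hA2
      obtain ⟨a, haA, ha⟩ := hA2
      have hap : a = p := by
        by_contra hap
        have := d2 u hu a (hAS a haA) (hAu a haA).symm
        rw [hu0, hmu, hmA a haA hap] at this
        rcases hval a v with h | h | h <;> rw [h] at this <;> omega
      subst hap
      have hr : ∀ c ∈ S, c ≠ a → c ≠ u → 28 ≤ m c → w c v = 2 := fun c hc hca hcu hmc =>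
        hpair a hpS c hc (Ne.symm hca) (hAu a hp) hcu hmp.ge hmc ha
      exact hAB.not_exchange hG himp hc hp hz huB (Ne.symm huz) hzredA hzx hzy
        (hr z hzS (hzA a hp).symm (Ne.symm huz) hmz.ge)
        (fun b hb hba => hr b (hAS b hb) hba (hAu b hb) (hmA' b hb))
        (hr x hxS (hAx a hp).symm hxu hmx.ge) (hr y hyS (hAy a hp).symm hyu hmy.ge)
        hBne (hne a hpS (hAu a hp))

/-- Some vertex outside a nonempty `B` has exactly two defects: a non-neighbour in `B` and a blue
neighbour in `A`. -/
theorem Config.exists_defect [Fintype V] (hr : 3 ≤ r) (hG : IsColoured w)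
    (hdeg : ∀ x : V,
      (14 * (r : ℝ) - 24) / (7 * (r : ℝ) - 5) * (Fintype.card V : ℝ) < ∑ y : V, (w x y : ℝ))
    (hN : NoClique w r) (himp : ¬ Improvable w r x y A.card) (hAB : Config w x y A B)
    (hxy : w x y = 1) (hc : 2 * A.card + B.card + 4 = 2 * r)
    (hB : 0 < B.card) :
    ∃ v, ∃ z ∈ B, ∃ p ∈ A, w z v = 0 ∧ w p v = 1 ∧
      ∀ u ∈ insert x (insert y (A ∪ B)), u ≠ z → u ≠ p → w u v = 2 := by
  by_contra! htwin
  have himp' : ¬ Improvable w r y x A.card := fun h => himp h.symm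
  have hG' := hG
  obtain ⟨hs, h2, h0⟩ := hG'
  have hyx : w y x = 1 := by rw [hs, hxy]
  have hAB' := hAB
  obtain ⟨a1, a2, a3, a4, a5, a6, a7⟩ := hAB'
  have hxA : x ∉ A := by grind
  have hyA : y ∉ A := by grind
  have hxB : x ∉ B := by grind
  have hyB : y ∉ B := by grind
  have hxy' : x ≠ y := by grind
  have hdisj : ∀ u ∈ A, u ∉ B := by grind
  set S := insert x (insert y (A ∪ B)) with hS
  replace htwin : ∀ v, ∀ z ∈ B, ∀ p ∈ A, w z v = 0 → w p v = 1 →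
      ¬ ∀ u ∈ S, u ≠ z → u ≠ p → w u v = 2 := by
    intro v z hz p hp hzv hpv h
    obtain ⟨u, hu, huz, hup, hne⟩ := htwin v z hz p hp hzv hpv
    exact hne (h u hu huz hup)
  have hAS : ∀ u ∈ A, u ∈ S := by grind
  have hBS : ∀ u ∈ B, u ∈ S := by grind
  have hxS : x ∈ S := by grind
  have hyS : y ∈ S := by grind
  have hzero : ∀ v, ∃ u ∈ S, w u v = 0 := fun v => hAB.exists_eq_zero hG hN hxy hc v
  have hSc : ∀ u ∈ S, u = x ∨ u = y ∨ u ∈ A ∨ u ∈ B := by grind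
  have hsumS : ∀ m : V → ℕ, ∑ u ∈ S, m u = m x + m y + ∑ u ∈ A, m u + ∑ u ∈ B, m u := by
    intro m
    rw [hS, Finset.sum_insert (by grind), Finset.sum_insert (by grind),
      Finset.sum_union (Finset.disjoint_left.2 hdisj)]
    ring
  have hval : ∀ a b, w a b = 0 ∨ w a b = 1 ∨ w a b = 2 := by
    intro a b
    have := h2 a b
    omega
  clear hS
  let m : V → ℕ := fun u => if u = x ∨ u = y then 28 else if u ∈ A then 42 else 20
  have hmx : m x = 28 := by simp [m]
  have hmy : m y = 28 := by simp [m]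
  have hmA : ∀ u ∈ A, m u = 42 := by grind
  have hmB : ∀ u ∈ B, m u = 20 := by grind
  have hsum : ∑ u ∈ S, m u + 30 ≤ 42 * r := by
    rw [hsumS, Finset.sum_congr rfl hmA, Finset.sum_congr rfl hmB]
    simp only [Finset.sum_const, smul_eq_mul]
    omega
  obtain ⟨v, d1, d2, d3⟩ := exists_small_deficiencies hr hG hdeg S m ⟨x, hxS⟩
    (fun u hu => by simp only [m]; split_ifs <;> omega) hsum
  have hm20 : ∀ u ∈ S, 20 ≤ m u := by grind
  have hm28 : ∀ u ∈ S, u ∉ B → 28 ≤ m u := by grind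
  clear_value m
  -- two non-neighbours, or a non-neighbour and an element of `A`, exclude all other defects
  have hthird : ∀ b ∈ S, ∀ c ∈ S, ∀ d ∈ S, b ≠ c → b ≠ d → c ≠ d → w b v = 0 →
      (w c v = 0 ∨ c ∈ A ∧ w c v ≠ 2) → (d ∉ B ∨ c ∈ A) → w d v = 2 := by
    intro b hb c hc d hd hbc hbd hcd hwb hwc hdB
    have e := d3 b hb c hc d hd hbc hbd hcd
    have e1 := hm20 b hb
    have e2 := hm20 c hc
    have e3 := hm20 d hd
    have e4 := hm28 d hd
    have e5 := hmA c
    rw [hwb] at e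
    rcases hval c v with h | h | h <;> rcases hval d v with h' | h' | h' <;>
      rw [h, h'] at e <;> grind
  have hfar : ∀ b ∈ S, b ∉ B → ∀ c ∈ S, b ≠ c → w b v = 0 → w c v ≠ 0 ∧ (c ∉ B → w c v = 2) := by
    intro b hb hbB c hc hbc hwb
    have e := d2 b hb c hc hbc
    have e1 := hm28 b hb hbB
    have e2 := hm20 c hc
    have e3 := hm28 c hc
    rw [hwb] at e
    rcases hval c v with h | h | h <;> rw [h] at e <;> grind
  have hAx : ∀ a ∈ A, a ≠ x := fun a ha => ne_of_mem_of_not_mem ha hxA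
  have hAy : ∀ a ∈ A, a ≠ y := fun a ha => ne_of_mem_of_not_mem ha hyA
  have hBx : ∀ b ∈ B, b ≠ x := fun b hb => ne_of_mem_of_not_mem hb hxB
  have hBy : ∀ b ∈ B, b ≠ y := fun b hb => ne_of_mem_of_not_mem hb hyB
  obtain ⟨u, hu, hu0⟩ := hzero v
  rcases hSc u hu with hux | huy | huA | huB
  · subst hux
    have hr := fun c hc hcu => hfar u hu hxB c hc (Ne.symm hcu) hu0
    exact hAB.not_replace hG hN hc (fun a ha => (hr a (hAS a ha) (hAx a ha)).2 (hdisj a ha))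
      ((hr y hyS hxy'.symm).2 hyB) (fun b hb => (hr b (hBS b hb) (hBx b hb)).1)
  · subst huy
    have hr := fun c hc hcu => hfar u hu hyB c hc (Ne.symm hcu) hu0
    exact hAB.symm.not_replace hG hN hc (fun a ha => (hr a (hAS a ha) (hAy a ha)).2 (hdisj a ha))
      ((hr x hxS hxy').2 hxB) (fun b hb => (hr b (hBS b hb) (hBy b hb)).1)
  · have := d1 u hu
    rw [hu0, hmA u huA] at this
    omega
  · have hnu : ∀ c ∉ B, c ≠ u := fun c hc h => hc (h ▸ huB)
    have hSB : ∀ c ∈ S, c ∉ B → w c v ≠ 0 := fun c hcS hcB h =>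
      (hfar c hcS hcB u hu (hnu c hcB) h).1 hu0
    by_cases htwo : ∃ u' ∈ B, u' ≠ u ∧ w u' v = 0
    · obtain ⟨u', hu'B, hne, hu'0⟩ := htwo
      have hred : ∀ d ∈ S, d ∉ B → w d v = 2 := fun d hd hdB =>
        hthird u hu u' (hBS u' hu'B) d hd (Ne.symm hne) (hnu d hdB).symm
          (fun h => hdB (h ▸ hu'B)) hu0 (Or.inl hu'0) (Or.inl hdB)
      refine hAB.not_red_of_two_zeros hG himp hc (v := v) (z' := u') huB
        (fun a ha => hred a (hAS a ha) (hdisj a ha)) (hred x hxS hxB) (hred y hyS hyB) ?_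
      intro d hdB hdu hdu' hd0
      have := d3 u hu u' (hBS u' hu'B) d (hBS d hdB) (Ne.symm hne) (Ne.symm hdu)
        (Ne.symm hdu')
      rw [hu0, hu'0, hd0, hmB u huB, hmB u' hu'B, hmB d hdB] at this
      omega
    push Not at htwo
    by_cases hA2 : ∀ a ∈ A, w a v = 2
    · by_cases hy : w y v = 2
      · exact hAB.not_swap_of_red_right hG hN himp hxy hc huB hA2 (hSB x hxS hxB) hy htwo
      · refine hAB.symm.not_swap_of_red_right hG hN himp' hyx hc huB hA2 (hSB y hyS hyB) ?_ htwo
        have e := d3 u hu y hyS x hxS (hnu y hyB).symm (hnu x hxB).symm hxy'.symm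
        rw [hu0, hmB u huB, hmx, hmy] at e
        rcases hval x v with h | h | h <;> rcases hval y v with h' | h' | h' <;>
          rw [h, h'] at e <;> omega
    · push Not at hA2
      obtain ⟨a, haA, ha⟩ := hA2
      have ha1 : w a v = 1 := by
        have := hSB a (hAS a haA) (hdisj a haA)
        rcases hval a v with h | h | h <;> omega
      refine htwin v u huB a haA hu0 ha1 ?_
      intro d hd hdu hda
      exact hthird u hu a (hAS a haA) d hd (hnu a (hdisj a haA)).symm (Ne.symm hdu)
        (Ne.symm hda) hu0 (Or.inr ⟨haA, ha⟩) (Or.inr haA)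

/-- A configuration all of whose maximality hypotheses hold has an empty blue part. -/
theorem Config.eq_empty [Fintype V] (hr : 3 ≤ r) (hG : IsColoured w)
    (hdeg : ∀ x : V,
      (14 * (r : ℝ) - 24) / (7 * (r : ℝ) - 5) * (Fintype.card V : ℝ) < ∑ y : V, (w x y : ℝ))
    (hN : NoClique w r) (himp : ¬ Improvable w r x y A.card) (hAB : Config w x y A B)
    (hxy : w x y = 1) (hc : 2 * A.card + B.card + 4 = 2 * r)
    (hmax : ∀ A' B' : Finset V, Config w x y A' B' → A'.card = A.card → B'.card = B.card →
      ∑ p ∈ insert x (insert y (A' ∪ B')), ∑ q ∈ insert x (insert y (A' ∪ B')), w p q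
        ≤ ∑ p ∈ insert x (insert y (A ∪ B)), ∑ q ∈ insert x (insert y (A ∪ B)), w p q) :
    B = ∅ := by
  by_contra hB
  have hBpos : 0 < B.card := Finset.card_pos.2 (Finset.nonempty_iff_ne_empty.2 hB)
  obtain ⟨v, z, hz, p, hp, hzv, hpv, hred⟩ := hAB.exists_defect hr hG hdeg hN himp hxy hc hBpos
  obtain ⟨q, hq, hqz, hzred⟩ := hAB.exists_twin hG hN himp hxy hc hmax hz hp hzv hpv hred
  exact hAB.not_twin hr hG hdeg hN himp hxy hc hz hq hqz hzred

end

/-- Lemma: in an extremal `𝓕_{2r}`-free coloured graph with minimum degree greater than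
`((14r-24)/(7r-5))·n`, every blue edge (weight `1`) is secure. -/
theorem blue_edges_secure {V : Type*} [Fintype V] (r : ℕ) (hr : 3 ≤ r)
    (w : V → V → ℕ) (hG : IsColoured w) (hext : Extremal w r)
    (hdeg : ∀ x : V,
      (14 * (r : ℝ) - 24) / (7 * (r : ℝ) - 5) * (Fintype.card V : ℝ) < ∑ y : V, (w x y : ℝ)) :
    ∀ x y : V, x ≠ y → w x y = 1 → Secure w r x y := by
  classical
  intro x y hxy h1
  have hN : NoClique w r := hext.1.noClique hG
  obtain ⟨A₀, B₀, h₀, hc₀⟩ := hext.exists_config hG hxy h1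
  let W : Finset V → Finset V → ℕ := fun A B =>
    ∑ p ∈ insert x (insert y (A ∪ B)), ∑ q ∈ insert x (insert y (A ∪ B)), w p q
  obtain ⟨⟨A, B⟩, hmem, hmax⟩ := Finset.exists_max_image
    (Finset.univ.filter fun P : Finset V × Finset V =>
      Config w x y P.1 P.2 ∧ 2 * P.1.card + P.2.card + 4 = 2 * r)
    (fun P => toLex (P.1.card, W P.1 P.2))
    ⟨(A₀, B₀), by
      simp only [Finset.mem_filter, Finset.mem_univ, true_and]
      exact ⟨h₀, by omega⟩⟩
  simp only [Finset.mem_filter, Finset.mem_univ, true_and, Prod.forall] at hmem hmax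
  obtain ⟨hAB, hc⟩ := hmem
  have hB : B.card = 0 := by
    by_contra hB0
    refine hB0 (Finset.card_eq_zero.2 ?_)
    refine hAB.eq_empty hr hG hdeg hN ?_ h1 hc ?_
    · rintro ⟨A', B', hAB', hA', hle⟩
      obtain ⟨B'', hB'', hcard⟩ := Finset.exists_subset_card_eq
        (show 2 * r - 4 - 2 * A'.card ≤ B'.card by omega)
      have := hmax A' B'' ⟨hAB'.mono hB'', by omega⟩
      rw [Prod.Lex.toLex_le_toLex] at this
      simp only at this
      omega
    · intro A' B' hAB' hA' hB'
      have := hmax A' B' ⟨hAB', by omega⟩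
      rw [Prod.Lex.toLex_le_toLex] at this
      simp only [hA', lt_irrefl, true_and, false_or] at this
      exact this
  refine ⟨A, by omega, ?_, ?_, hAB.red, fun a ha => ⟨hAB.red_left a ha, hAB.red_right a ha⟩⟩
  · intro hx
    have := hAB.red_left x hx
    rw [hG.2.2] at this
    omega
  · intro hy
    have := hAB.red_right y hy
    rw [hG.2.2] at this
    omega
end
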